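/- arXiv:0710.0642 — 4 statements merged into one kernel-verified Lean document; each statement's English description precedes it below -/
import Mathlib

section
/- There is an absolute constant C > 0 with the following property. Let N be a positive integer, let A, B ⊆ ℤ/Nℤ be nonempty sets with |A + B| ≤ K·|B| for a real K ≥ 1, and let α := |A|/N. Then there exist finite sets of frequencies Γ, Λ ⊆ ℤ/Nℤ and reals δ, ε ∈ (0,1] such that B(Γ,δ) ∩ B(Λ,ε) ⊆ (A − A) + (B − B), with |Γ| ≤ C·K^{1/2}·(1 + log α⁻¹), log δ⁻¹ ≤ C·K^{1/4}·(1 + log α⁻¹)·(1 + log(K·α⁻¹)), |Λ| ≤ C·K^{3/4}·(1 + log α⁻¹), and log ε⁻¹ ≤ C·(1 + log(K·(1 + log α⁻¹))). -/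
open Finset Complex
open scoped Pointwise BigOperators ComplexConjugate

/-- Distance from a real number to the nearest integer. -/
noncomputable def nint (r : ℝ) : ℝ := |r - round r|

open Classical in
/-- The Bohr set `B(Γ, δ)` in `ℤ/Nℤ`: all `x` with `‖t x / N‖ ≤ δ` for every frequency
`t ∈ Γ`, where `‖·‖` is the distance to the nearest integer. -/
noncomputable def bohr (N : ℕ) [NeZero N] (Γ : Finset (ZMod N)) (δ : ℝ) : Finset (ZMod N) :=
  Finset.univ.filter fun x => ∀ t ∈ Γ, nint (((t * x).val : ℝ) / N) ≤ δ

/-- Regularity of the Bohr set `B(Γ, δ)`. -/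
def BohrRegular (N : ℕ) [NeZero N] (Γ : Finset (ZMod N)) (δ : ℝ) : Prop :=
  ∀ η : ℝ, (Γ.card : ℝ) * |η| ≤ ((2 : ℝ) ^ 4)⁻¹ →
    (1 - 2 ^ 4 * Γ.card * |η|) * (bohr N Γ δ).card ≤ ((bohr N Γ ((1 + η) * δ)).card : ℝ) ∧
    ((bohr N Γ ((1 + η) * δ)).card : ℝ) ≤ (1 + 2 ^ 4 * Γ.card * |η|) * (bohr N Γ δ).card

/-- The character of `ℤ/Nℤ` associated with the frequency `t`, evaluated at `x`:
`γ_t(x) = e^{2πi t x / N}`. -/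
noncomputable def chr (N : ℕ) [NeZero N] (t x : ZMod N) : ℂ :=
  Complex.exp (2 * Real.pi * Complex.I * (((t * x).val : ℕ) : ℂ) / N)

/-- The Fourier transform of the uniform probability measure `β_{Γ,δ}` on `B(Γ,δ)` at the
frequency `t`: `β̂_{Γ,δ}(t) = |B(Γ,δ)|⁻¹ Σ_{x ∈ B(Γ,δ)} e^{-2πi t x / N}`. -/
noncomputable def bohrFourier (N : ℕ) [NeZero N] (Γ : Finset (ZMod N)) (δ : ℝ) (t : ZMod N) : ℂ :=
  ((bohr N Γ δ).card : ℂ)⁻¹ *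
    ∑ x ∈ bohr N Γ δ, Complex.exp (-(2 * Real.pi * Complex.I * (((t * x).val : ℕ) : ℂ) / N))

/-- A finite set `Λ` in an abelian group is `S`-dissociated if the only `{-1,0,1}`-valued
assignment `m` on `Λ` with `Σ_{λ ∈ Λ} m(λ)·λ ∈ S` is `m ≡ 0`. -/
def SDissociated {G : Type*} [AddCommGroup G] (S : Set G) (Λ : Finset G) : Prop :=
  ∀ m : G → ℤ, (∀ l ∈ Λ, m l = -1 ∨ m l = 0 ∨ m l = 1) →
    (∑ l ∈ Λ, m l • l) ∈ S → ∀ l ∈ Λ, m l = 0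

lemma pow4_sum {ι : Type*} (s : Finset ι) (f : ι → ℝ) :
    (∑ i ∈ s, f i) ^ 4 ≤ (s.card : ℝ) ^ 3 * ∑ i ∈ s, f i ^ 4 := by
  have h1 : (∑ i ∈ s, f i) ^ 2 ≤ s.card * ∑ i ∈ s, f i ^ 2 := sq_sum_le_card_mul_sum_sq
  have h2 : (∑ i ∈ s, f i ^ 2) ^ 2 ≤ s.card * ∑ i ∈ s, (f i ^ 2) ^ 2 := sq_sum_le_card_mul_sum_sq
  have h3 : ∀ i, (f i ^ 2) ^ 2 = f i ^ 4 := fun i => by ring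
  simp only [h3] at h2
  calc (∑ i ∈ s, f i) ^ 4 = ((∑ i ∈ s, f i) ^ 2) ^ 2 := by ring
    _ ≤ (s.card * ∑ i ∈ s, f i ^ 2) ^ 2 := by gcongr
    _ = (s.card : ℝ) ^ 2 * (∑ i ∈ s, f i ^ 2) ^ 2 := by ring
    _ ≤ (s.card : ℝ) ^ 2 * (s.card * ∑ i ∈ s, f i ^ 4) := by gcongr
    _ = _ := by ring

section moments
variable {α : Type*} [Fintype α]

lemma sum_cons (k : ℕ) (X : α → ℝ) (g : ℝ → ℝ) :
    ∑ v : Fin (k + 1) → α, g (∑ i, X (v i)) =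
      ∑ a, ∑ v : Fin k → α, g (X a + ∑ i, X (v i)) := by
  rw [← Fintype.sum_prod_type', ← (Fin.consEquiv (fun _ => α)).sum_comp]
  simp [Fin.consEquiv, Fin.sum_univ_succ]

lemma mom1 (X : α → ℝ) (h0 : ∑ a, X a = 0) (k : ℕ) :
    ∑ v : Fin k → α, (∑ i, X (v i)) = 0 := by
  induction k with
  | zero => simp
  | succ k ih =>
    rw [sum_cons k X (fun t => t)]
    simp only [sum_add_distrib, ih, sum_const, nsmul_eq_mul, mul_zero, add_zero, ← mul_sum, h0]

lemma mom2 (X : α → ℝ) (h0 : ∑ a, X a = 0) (k : ℕ) :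
    (Fintype.card α : ℝ) * ∑ v : Fin k → α, (∑ i, X (v i)) ^ 2 =
      k * (Fintype.card α : ℝ) ^ k * ∑ a, X a ^ 2 := by
  induction k with
  | zero => simp
  | succ k ih =>
    rw [sum_cons k X (fun t => t ^ 2)]
    simp only [add_sq, sum_add_distrib, sum_const, nsmul_eq_mul, ← mul_sum, mom1 X h0 k, mul_zero]
    simp only [Finset.card_univ, Fintype.card_pi, prod_const, Fintype.card_fin] at ih ⊢
    push_cast
    rw [add_zero, mul_add, ih]
    ring

lemma mom4 (X : α → ℝ) (h0 : ∑ a, X a = 0) (h1 : ∀ a, |X a| ≤ 1) (k : ℕ) :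
    (Fintype.card α : ℝ) * ∑ v : Fin k → α, (∑ i, X (v i)) ^ 4 ≤
      3 * k ^ 2 * (Fintype.card α : ℝ) ^ k * ∑ a, X a ^ 2 := by
  have hsq : ∀ a, X a ^ 2 ≤ 1 := fun a => by
    rw [← sq_abs]; exact pow_le_one₀ (abs_nonneg _) (h1 a)
  induction k with
  | zero => simp
  | succ k ih =>
    rw [sum_cons k X (fun t => t ^ 4)]
    have e : ∀ x y : ℝ, (x + y) ^ 4 = x ^ 4 + 4 * x ^ 3 * y + 6 * x ^ 2 * y ^ 2 + 4 * x * y ^ 3 + y ^ 4 := by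
      intros; ring
    have m2 := mom2 X h0 k
    simp only [e, sum_add_distrib, sum_const, nsmul_eq_mul, ← mul_sum, mom1 X h0 k, mul_zero]
    simp only [← sum_mul, ← mul_sum, h0]
    simp only [Finset.card_univ, Fintype.card_pi, prod_const, Fintype.card_fin] at ih m2 ⊢
    push_cast
    set n : ℝ := (Fintype.card α : ℝ)
    set Q := ∑ a, X a ^ 2
    set M2 := ∑ v : Fin k → α, (∑ i, X (v i)) ^ 2
    set M4 := ∑ v : Fin k → α, (∑ i, X (v i)) ^ 4
    have hQ0 : 0 ≤ Q := sum_nonneg fun a _ => sq_nonneg _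
    have hQn : Q ≤ n := by
      calc Q ≤ ∑ a : α, (1 : ℝ) := sum_le_sum fun a _ => hsq a
        _ = n := by simp [n]
    have hX4 : ∑ a, X a ^ 4 ≤ Q := sum_le_sum fun a _ => by nlinarith [hsq a, sq_nonneg (X a)]
    have hn : 0 ≤ n := Nat.cast_nonneg _
    have hnk : 0 ≤ n ^ k := pow_nonneg hn k
    have a1 : n * (n * M4) ≤ n * (3 * k ^ 2 * n ^ k * Q) := by gcongr
    have a2 : n * (6 * Q * M2) ≤ n * (6 * k * n ^ k * Q) := by
      have : n * (6 * Q * M2) = 6 * k * n ^ k * Q * Q := by linear_combination 6 * Q * m2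
      rw [this]
      have : 6 * k * n ^ k * Q * Q ≤ 6 * k * n ^ k * Q * n := by gcongr
      linarith
    have a3 : n * (n ^ k * ∑ a, X a ^ 4) ≤ n * (n ^ k * Q) := by gcongr
    have a4 : 0 ≤ n * (n ^ k * Q) := by positivity
    rw [pow_succ n k]
    nlinarith
end moments

section four
variable {N : ℕ} [NeZero N]

/-- The standard character of `ℤ/Nℤ`. -/
noncomputable def ec (x : ZMod N) : ℂ := ZMod.stdAddChar x

lemma ec_add (x y : ZMod N) : ec (x + y) = ec x * ec y := AddChar.map_add_eq_mul _ _ _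
lemma ec_zero : ec (0 : ZMod N) = 1 := AddChar.map_zero_eq_one _
lemma ec_norm (x : ZMod N) : ‖ec x‖ = 1 := by
  unfold ec; rw [ZMod.stdAddChar_apply]; exact Circle.norm_coe _
lemma ec_neg (x : ZMod N) : ec (-x) = conj (ec x) := AddChar.map_neg_eq_conj _ _

lemma orth (b : ZMod N) : ∑ x : ZMod N, ec (b * x) = if b = 0 then (N : ℂ) else 0 := by
  have := AddChar.sum_mulShift b (ZMod.isPrimitive_stdAddChar N)
  simp only [ZMod.card] at this
  simp only [mul_comm b, ec]
  exact_mod_cast this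

lemma parseval (g : ZMod N → ℂ) : ∑ r, ‖∑ y, g y * ec (r * y)‖ ^ 2 = N * ∑ y, ‖g y‖ ^ 2 := by
  have key : ∀ y z r : ZMod N, g y * ec (r * y) * (conj (g z) * ec (-(r * z))) =
        g y * conj (g z) * ec ((y - z) * r) := by
      intro y z r
      rw [show (y - z) * r = r * y + -(r * z) by ring, ec_add]; ring
  have : (∑ r, (‖∑ y, g y * ec (r * y)‖ : ℂ) ^ 2 : ℂ) = N * ∑ y, (‖g y‖ : ℂ) ^ 2 := by
    simp only [← Complex.mul_conj', map_sum, map_mul, ← ec_neg, sum_mul_sum, key]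
    rw [sum_comm, mul_sum]
    refine sum_congr rfl fun y _ => ?_
    rw [sum_comm]
    simp only [← mul_sum, orth, sub_eq_zero]
    simp; ring
  exact_mod_cast this

lemma inversion (F : ZMod N → ℂ) (y : ZMod N) :
    F y = ∑ r, ((N : ℂ)⁻¹ * ∑ z, F z * ec (r * z)) * ec (-(r * y)) := by
  have hN : (N : ℂ) ≠ 0 := Nat.cast_ne_zero.2 (NeZero.ne N)
  have : ∀ z r, F z * ec (r * z) * ec (-(r * y)) = F z * ec ((z - y) * r) := by
      intro z r
      rw [show (z - y) * r = r * z + -(r * y) by ring, ec_add]; ring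
  simp only [mul_assoc, ← mul_sum, sum_mul]
  simp only [← mul_assoc, this]
  rw [sum_comm]
  simp only [← mul_sum, orth, sub_eq_zero]
  simp
  field_simp

lemma ec_sum {ι : Type*} (s : Finset ι) (f : ι → ZMod N) :
    ec (∑ i ∈ s, f i) = ∏ i ∈ s, ec (f i) := by
  classical
  induction s using Finset.induction_on with
  | empty => simp [ec_zero]
  | insert a s ha ih => rw [sum_insert ha, prod_insert ha, ec_add, ih]

lemma riesz (Λ : Finset (ZMod N)) (hΛ : AddDissociated (Λ : Set (ZMod N))) (a : ℂ)
    (c d : ZMod N → ℂ) :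
    ∑ x, ∏ r ∈ Λ, (a + (c r * ec (r * x) + d r * ec (-(r * x)))) = N * a ^ Λ.card := by
  classical
  simp only [prod_add]
  rw [sum_comm, sum_eq_single Λ]
  · simp
  · intro s hs hne
    rw [mem_powerset] at hs
    rw [← mul_sum, sum_comm, sum_eq_zero, mul_zero]
    intro u hu
    rw [mem_powerset] at hu
    have hx : ∀ x : ZMod N, (∏ r ∈ u, c r * ec (r * x)) * ∏ r ∈ (Λ \ s) \ u, d r * ec (-(r * x)) =
        ((∏ r ∈ u, c r) * ∏ r ∈ (Λ \ s) \ u, d r) *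
          ec ((∑ r ∈ u, r - ∑ r ∈ (Λ \ s) \ u, r) * x) := by
      intro x
      rw [sub_mul, sub_eq_add_neg, ec_add, sum_mul, sum_mul, ← sum_neg_distrib, ec_sum, ec_sum,
        prod_mul_distrib, prod_mul_distrib]
      ring
    simp only [hx]
    rw [← mul_sum, orth, if_neg, mul_zero]
    intro h0
    rw [sub_eq_zero] at h0
    have h1 : u = (Λ \ s) \ u := by
      apply hΛ _ _ h0
      · exact_mod_cast hu.trans sdiff_subset
      · show ((((Λ \ s) \ u : Finset _)) : Set (ZMod N)) ⊆ (Λ : Set (ZMod N))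
        exact_mod_cast sdiff_subset.trans sdiff_subset
    have h2 : u = ∅ := by
      apply eq_empty_of_forall_notMem
      intro z hz
      have := hz
      rw [h1, mem_sdiff] at this
      exact this.2 hz
    have h3 : Λ \ s = ∅ := by
      rw [h2] at h1; simpa using h1.symm
    exact hne (subset_antisymm hs (sdiff_eq_empty_iff_subset.1 h3))
  · intro h; simp at h

lemma chang (T Λ : Finset (ZMod N)) (hΛ : AddDissociated (Λ : Set (ZMod N)))
    (hT : ∀ r ∈ Λ, (T.card : ℝ) / 2 ≤ ‖∑ t ∈ T, ec (r * t)‖) :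
    (T.card : ℝ) * Real.exp (Λ.card / 8) ≤ N := by
  classical
  have hc : ∀ z : ℂ, ∃ c : ℂ, ‖c‖ = 1 ∧ (c * z).re = ‖z‖ := by
    intro z
    rcases eq_or_ne z 0 with rfl | hz
    · exact ⟨1, by simp, by simp⟩
    · refine ⟨conj z / ‖z‖, ?_, ?_⟩
      · rw [norm_div]; simp [hz]
      · rw [div_mul_eq_mul_div, mul_comm, Complex.mul_conj', sq, mul_div_assoc, div_self]
        · simp
        · simpa using hz
  choose cc hc1 hc2 using hc
  set c : ZMod N → ℂ := fun r => cc (∑ t ∈ T, ec (r * t)) with hcdef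
  set Y : ZMod N → ZMod N → ℝ := fun x r => (c r * ec (r * x)).re with hY
  have hY1 : ∀ x r, |Y x r| ≤ 1 := by
    intro x r
    refine (Complex.abs_re_le_norm _).trans ?_
    rw [norm_mul, ec_norm, hcdef]; simp [hc1]
  have hYsum : ∀ r, ∑ t ∈ T, Y t r = ‖∑ t ∈ T, ec (r * t)‖ := by
    intro r
    rw [← hc2, mul_sum, Complex.re_sum]
  have hriesz : ∑ x, ∏ r ∈ Λ, (Real.cosh (1/2) + Y x r * Real.sinh (1/2)) =
      N * Real.cosh (1/2) ^ Λ.card := by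
    have := riesz Λ hΛ (Real.cosh (1/2) : ℝ) (fun r => c r * (Real.sinh (1/2) : ℝ) / 2)
      (fun r => conj (c r) * (Real.sinh (1/2) : ℝ) / 2)
    have h2 : ∀ x r, ((Real.cosh (1/2) : ℝ) : ℂ) + (c r * (Real.sinh (1/2) : ℝ) / 2 * ec (r * x) +
        conj (c r) * (Real.sinh (1/2) : ℝ) / 2 * ec (-(r * x))) =
        ((Real.cosh (1/2) + Y x r * Real.sinh (1/2) : ℝ) : ℂ) := by
      intro x r
      have := Complex.re_eq_add_conj (c r * ec (r * x))
      simp only [hY]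
      push_cast [-Complex.ofReal_cosh, -Complex.ofReal_sinh]
      rw [this, ec_neg, map_mul]; ring
    simp only [h2] at this
    exact_mod_cast this
  set n : ℝ := (Λ.card : ℝ) with hn
  have hup : ∑ x, Real.exp (1/2 * ∑ r ∈ Λ, Y x r) ≤ N * Real.exp (n / 8) := by
    calc ∑ x, Real.exp (1/2 * ∑ r ∈ Λ, Y x r)
        ≤ ∑ x, ∏ r ∈ Λ, (Real.cosh (1/2) + Y x r * Real.sinh (1/2)) := by
          refine sum_le_sum fun x _ => ?_
          rw [mul_sum, Real.exp_sum]
          exact prod_le_prod (fun _ _ => (Real.exp_pos _).le)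
            fun r _ => by
              rw [mul_comm]; exact Real.exp_mul_le_cosh_add_mul_sinh (hY1 x r) _
      _ = N * Real.cosh (1/2) ^ Λ.card := hriesz
      _ ≤ N * Real.exp ((1/2) ^ 2 / 2) ^ Λ.card := by
          gcongr
          exact Real.cosh_le_exp_half_sq _
      _ = N * Real.exp (n / 8) := by
          rw [← Real.exp_nat_mul]; congr 2; rw [hn]; ring
  have hlow : (T.card : ℝ) * Real.exp (n / 4) ≤ ∑ x, Real.exp (1/2 * ∑ r ∈ Λ, Y x r) := by
    have h1 : (T.card : ℝ) * (n / 2) ≤ ∑ t ∈ T, ∑ r ∈ Λ, Y t r := by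
      rw [sum_comm]
      calc (T.card : ℝ) * (n / 2) = ∑ r ∈ Λ, (T.card : ℝ) / 2 := by simp [hn]; ring
        _ ≤ _ := sum_le_sum fun r hr => by rw [hYsum]; exact hT r hr
    calc (T.card : ℝ) * Real.exp (n / 4)
        ≤ ∑ t ∈ T, Real.exp (n / 4) * (1 + (1/2 * ∑ r ∈ Λ, Y t r - n / 4)) := by
          rw [← mul_sum, sum_add_distrib, sum_sub_distrib, ← mul_sum]
          simp only [sum_const, nsmul_eq_mul, mul_one]
          rw [mul_comm]
          gcongr
          linarith
      _ ≤ ∑ t ∈ T, Real.exp (1/2 * ∑ r ∈ Λ, Y t r) := by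
          refine sum_le_sum fun t _ => ?_
          have := Real.add_one_le_exp (1/2 * ∑ r ∈ Λ, Y t r - n / 4)
          calc _ ≤ Real.exp (n / 4) * Real.exp (1/2 * ∑ r ∈ Λ, Y t r - n / 4) := by
                gcongr; linarith
            _ = _ := by rw [← Real.exp_add]; congr 1; ring
      _ ≤ _ := sum_le_sum_of_subset_of_nonneg (subset_univ _) fun _ _ _ => (Real.exp_pos _).le
  have h := hlow.trans hup
  have h4 : Real.exp (n / 4) = Real.exp (n / 8) * Real.exp (n / 8) := by
    rw [← Real.exp_add]; congr 1; ring
  rw [h4, ← mul_assoc] at h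
  exact le_of_mul_le_mul_right h (Real.exp_pos _)

lemma bohr_single (Λ : Finset (ZMod N)) (ε : ℝ) (x : ZMod N) (hx : x ∈ bohr N Λ ε) (r : ZMod N)
    (hr : r ∈ Λ) : ‖ec (r * x) - 1‖ ≤ 2 * Real.pi * ε := by
  classical
  simp only [bohr, mem_filter, mem_univ, true_and] at hx
  have h := hx r hr
  unfold nint at h
  set q : ℝ := ((r * x).val : ℝ) / N
  have : ec (r * x) = Complex.exp (I * ((2 * Real.pi * (q - round q) : ℝ) : ℂ)) := by
    unfold ec
    rw [ZMod.stdAddChar_apply, ZMod.toCircle_apply, Complex.exp_eq_exp_iff_exists_int]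
    refine ⟨round q, ?_⟩
    simp only [q]
    push_cast
    ring
  rw [this]
  refine Real.norm_exp_I_mul_ofReal_sub_one_le.trans ?_
  rw [Real.norm_eq_abs, abs_mul, abs_of_pos (by positivity : 0 < 2 * Real.pi)]
  gcongr

lemma bohr_span (Λ : Finset (ZMod N)) (ε : ℝ) (hε : 0 ≤ ε) (x : ZMod N) (hx : x ∈ bohr N Λ ε)
    (r : ZMod N) (hr : r ∈ addSpan Λ) : ‖ec (r * x) - 1‖ ≤ Λ.card * (2 * Real.pi * ε) := by
  classical
  rw [mem_addSpan] at hr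
  obtain ⟨s, hs, rfl⟩ := hr
  have hadd : ∀ a b : ZMod N, ‖ec ((a + b) * x) - 1‖ ≤ ‖ec (a * x) - 1‖ + ‖ec (b * x) - 1‖ := by
    intro a b
    rw [add_mul, ec_add]
    calc _ = ‖ec (a * x) * (ec (b * x) - 1) + (ec (a * x) - 1)‖ := by congr 1; ring
      _ ≤ _ := by
        refine (norm_add_le _ _).trans ?_
        rw [norm_mul, ec_norm]; linarith
  calc ‖ec ((∑ a ∈ Λ, s a • a) * x) - 1‖ ≤ ∑ a ∈ Λ, ‖ec ((s a • a) * x) - 1‖ :=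
        Finset.le_sum_of_subadditive (fun a : ZMod N => ‖ec (a * x) - 1‖) (by simp [ec_zero]) hadd _ _
    _ ≤ ∑ a ∈ Λ, 2 * Real.pi * ε := by
        refine sum_le_sum fun a ha => ?_
        have h1 := bohr_single Λ ε x hx a ha
        rcases hs a with h | h | h
        · rw [h, neg_one_smul, neg_mul, ec_neg]
          rwa [← map_one (starRingEnd ℂ), ← map_sub, Complex.norm_conj]
        · rw [h, zero_smul, zero_mul, ec_zero]; simp; positivity
        · rwa [h, one_smul]
    _ = _ := by simp

end four
set_option linter.unusedSectionVars false

section cs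
variable {N : ℕ} [NeZero N]

open Classical in
/-- Indicator of `S`. -/
noncomputable def ind (S : Finset (ZMod N)) (x : ZMod N) : ℝ := if x ∈ S then 1 else 0

lemma sum_shift4 (f : ZMod N → ℝ) (a : ZMod N) : ∑ y, f (y + a) = ∑ y, f y :=
  Equiv.sum_comp (Equiv.addRight a) f

lemma ind_sum (S : Finset (ZMod N)) (a : ZMod N) : ∑ y, ind S (y + a) = S.card := by
  rw [sum_shift4 (ind S)]
  simp [ind]

/-- The average of `1_S(y + a)` over `a ∈ A`. -/
noncomputable def avF (A S : Finset (ZMod N)) (y : ZMod N) : ℝ :=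
  (∑ a ∈ A, ind S (y + a)) / A.card

lemma ind_nonneg (S : Finset (ZMod N)) (x : ZMod N) : 0 ≤ ind S x := by
  unfold ind; split_ifs <;> norm_num
lemma ind_le_one (S : Finset (ZMod N)) (x : ZMod N) : ind S x ≤ 1 := by
  unfold ind; split_ifs <;> norm_num

lemma avF_nonneg (A S : Finset (ZMod N)) (y : ZMod N) : 0 ≤ avF A S y :=
  div_nonneg (sum_nonneg fun _ _ => ind_nonneg _ _) (Nat.cast_nonneg _)

lemma avF_le_one (A S : Finset (ZMod N)) (y : ZMod N) : avF A S y ≤ 1 := by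
  refine div_le_one_of_le₀ ?_ (Nat.cast_nonneg _)
  calc _ ≤ ∑ a ∈ A, (1 : ℝ) := sum_le_sum fun _ _ => ind_le_one _ _
    _ = _ := by simp

lemma avF_sum (A S : Finset (ZMod N)) (hA : A.Nonempty) : ∑ y, avF A S y = S.card := by
  have : (A.card : ℝ) ≠ 0 := by simpa using hA.ne_empty
  unfold avF
  rw [← sum_div, sum_comm]
  simp only [ind_sum, sum_const, nsmul_eq_mul]
  field_simp

lemma avF_sq_sum (A S : Finset (ZMod N)) (hA : A.Nonempty) : ∑ y, avF A S y ^ 2 ≤ S.card := by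
  rw [← avF_sum A S hA]
  exact sum_le_sum fun y _ => by nlinarith [avF_nonneg A S y, avF_le_one A S y]

lemma mom_point (A S : Finset (ZMod N)) (hA : A.Nonempty) (k : ℕ) (hk : 0 < k) (y : ZMod N) :
    ∑ v : Fin k → A, ((∑ i, ind S (y + v i)) / k - avF A S y) ^ 4 ≤
      3 / k ^ 2 * (A.card : ℝ) ^ k * avF A S y := by
  have hA0 : (0 : ℝ) < A.card := by simpa using hA.card_pos
  have hk0 : (0 : ℝ) < k := by exact_mod_cast hk
  set X : A → ℝ := fun a => ind S (y + a) - avF A S y with hX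
  have hs : ∑ a : A, ind S (y + a) = A.card * avF A S y := by
    rw [sum_coe_sort A (fun a => ind S (y + a))]; unfold avF; field_simp
  have h0 : ∑ a, X a = 0 := by
    simp only [hX, sum_sub_distrib, hs]; simp
  have h1 : ∀ a, |X a| ≤ 1 := fun a => by
    have := avF_nonneg A S y
    have := avF_le_one A S y
    have := ind_nonneg S (y + a)
    have := ind_le_one S (y + a)
    rw [abs_le]; constructor <;> simp only [hX] <;> linarith
  have hQ : ∑ a, X a ^ 2 ≤ A.card * avF A S y := by
    have e : ∀ a : A, X a ^ 2 = ind S (y + a) - 2 * avF A S y * ind S (y + a) + avF A S y ^ 2 := by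
      intro a
      have : ind S (y + a) ^ 2 = ind S (y + a) := by unfold ind; split_ifs <;> norm_num
      simp only [hX]; linear_combination this
    simp only [e, sum_add_distrib, sum_sub_distrib, ← mul_sum, hs]
    simp only [sum_const, card_univ, Fintype.card_coe, nsmul_eq_mul]
    nlinarith [mul_nonneg hA0.le (sq_nonneg (avF A S y))]
  have m := mom4 X h0 h1 k
  rw [Fintype.card_coe] at m
  have e : ∀ v : Fin k → A, ((∑ i, ind S (y + v i)) / k - avF A S y) ^ 4 =
      (∑ i, X (v i)) ^ 4 / k ^ 4 := by
    intro v
    rw [← div_pow]; congr 1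
    simp only [hX, sum_sub_distrib, sum_const, card_univ, Fintype.card_fin, nsmul_eq_mul]
    field_simp
  simp only [e, ← sum_div]
  rw [div_le_iff₀ (by positivity)]
  have m2 : (A.card : ℝ) * ∑ v : Fin k → A, (∑ i, X (v i)) ^ 4 ≤
      A.card * (3 * k ^ 2 * (A.card : ℝ) ^ k * avF A S y) := by
    refine m.trans ?_
    calc _ ≤ 3 * k ^ 2 * (A.card : ℝ) ^ k * (A.card * avF A S y) := by gcongr
      _ = _ := by ring
  refine (le_of_mul_le_mul_left m2 hA0).trans (le_of_eq ?_)
  field_simp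

lemma croot_sisask (A S : Finset (ZMod N)) (hA : A.Nonempty) (hS : S.Nonempty)
    (k : ℕ) (hk : 0 < k) :
    ∃ (T : Finset (ZMod N)) (h : ZMod N → ℝ),
      (N : ℝ) * (A.card : ℝ) ^ k ≤ 2 * (T.card * (N : ℝ) ^ k) ∧
      ∀ t ∈ T, ∑ y, (avF A S (y + t) - h y) ^ 4 ≤ 6 * S.card / k ^ 2 := by
  classical
  have hA0 : (0 : ℝ) < A.card := by simpa using hA.card_pos
  have hS0 : (0 : ℝ) < S.card := by simpa using hS.card_pos
  have hk0 : (0 : ℝ) < k := by exact_mod_cast hk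
  set c : ℝ := 6 * S.card / k ^ 2 with hc
  have hc0 : 0 < c := by positivity
  set Fv : (Fin k → ZMod N) → ZMod N → ℝ := fun v y => (∑ i, ind S (y + v i)) / k with hFv
  set D : (Fin k → ZMod N) → ℝ := fun v => ∑ y, (Fv v y - avF A S y) ^ 4 with hD
  set ι : (Fin k → A) → (Fin k → ZMod N) := fun v i => v i with hι
  have hιi : Function.Injective ι := by
    intro v w h; funext i; exact Subtype.ext (congrFun h i)
  have hD0 : ∀ v, 0 ≤ D v := fun v => sum_nonneg fun y _ => by positivity
  have hDsum : ∑ v : Fin k → A, D (ι v) ≤ c / 2 * (A.card : ℝ) ^ k := by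
    simp only [hD]
    rw [sum_comm]
    calc _ ≤ ∑ y, 3 / k ^ 2 * (A.card : ℝ) ^ k * avF A S y :=
          sum_le_sum fun y _ => mom_point A S hA k hk y
      _ = _ := by rw [← mul_sum, avF_sum A S hA, hc]; ring
  set good : Finset (Fin k → A) := univ.filter fun v => D (ι v) ≤ c with hgood
  set bad : Finset (Fin k → A) := univ.filter fun v => ¬ D (ι v) ≤ c with hbad
  have hcard : (good.card : ℝ) + bad.card = (A.card : ℝ) ^ k := by
    have := card_filter_add_card_filter_not (s := (univ : Finset (Fin k → A))) (fun v => D (ι v) ≤ c)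
    rw [card_univ, Fintype.card_pi] at this
    simp only [Fintype.card_coe, prod_const, card_univ, Fintype.card_fin] at this
    exact_mod_cast this
  have hbadc : c * bad.card ≤ c / 2 * (A.card : ℝ) ^ k := by
    refine le_trans ?_ hDsum
    calc c * bad.card = ∑ v ∈ bad, c := by simp; ring
      _ ≤ ∑ v ∈ bad, D (ι v) := sum_le_sum fun v hv => by
          rw [hbad, mem_filter] at hv; exact (not_le.1 hv.2).le
      _ ≤ _ := sum_le_sum_of_subset_of_nonneg (subset_univ _) fun v _ _ => hD0 _
  have hgoodc : (A.card : ℝ) ^ k ≤ 2 * good.card := by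
    have : (bad.card : ℝ) ≤ (A.card : ℝ) ^ k / 2 := by
      refine le_of_mul_le_mul_left ?_ hc0; linarith
    linarith
  set L : Finset (Fin k → ZMod N) := good.image ι with hL
  have hLc : L.card = good.card := card_image_of_injective _ hιi
  have hcount : ∑ w : Fin k → ZMod N, ((univ.filter fun t : ZMod N => (fun i => w i - t) ∈ L).card : ℝ)
      = N * L.card := by
    have : ∀ w : Fin k → ZMod N, ((univ.filter fun t : ZMod N => (fun i => w i - t) ∈ L).card : ℝ) =
        ∑ t : ZMod N, if (fun i => w i - t) ∈ L then (1 : ℝ) else 0 := by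
      intro w; simp
    simp only [this]
    rw [sum_comm]
    have h2 : ∀ t : ZMod N, ∑ w : Fin k → ZMod N, (if (fun i => w i - t) ∈ L then (1 : ℝ) else 0) =
        L.card := by
      intro t
      have := Equiv.sum_comp (Equiv.subRight (fun _ : Fin k => t))
        (fun w : Fin k → ZMod N => if w ∈ L then (1 : ℝ) else 0)
      calc _ = ∑ w : Fin k → ZMod N, (if w ∈ L then (1 : ℝ) else 0) := by
            rw [← this]; rfl
        _ = _ := by simp
    simp [h2]
  obtain ⟨w, hw⟩ : ∃ w : Fin k → ZMod N, (N : ℝ) * L.card ≤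
      (univ.filter fun t : ZMod N => (fun i => w i - t) ∈ L).card * (N : ℝ) ^ k := by
    by_contra! hcon
    have h3 : ∑ w : Fin k → ZMod N,
        ((univ.filter fun t : ZMod N => (fun i => w i - t) ∈ L).card : ℝ) * (N : ℝ) ^ k <
        ∑ w : Fin k → ZMod N, (N : ℝ) * L.card :=
      sum_lt_sum_of_nonempty univ_nonempty fun w _ => hcon w
    rw [← sum_mul, hcount] at h3
    simp [Fintype.card_pi, ZMod.card] at h3
    linarith
  refine ⟨univ.filter fun t : ZMod N => (fun i => w i - t) ∈ L, Fv w, ?_, ?_⟩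
  · rw [hLc] at hw
    have hN : (0 : ℝ) ≤ N := Nat.cast_nonneg _
    nlinarith [mul_le_mul_of_nonneg_left hgoodc hN]
  · intro t ht
    simp only [mem_filter, mem_univ, true_and, hL, mem_image] at ht
    obtain ⟨v, hv, hvw⟩ := ht
    rw [hgood, mem_filter] at hv
    refine le_trans (le_of_eq ?_) hv.2
    rw [hvw]
    simp only [hD]
    refine Eq.trans ?_ (sum_shift4 (fun y => (Fv (fun i => w i - t) y - avF A S y) ^ 4) t)
    refine sum_congr rfl fun y _ => ?_
    have : Fv (fun i => w i - t) (y + t) = Fv w y := by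
      simp only [hFv]
      congr 1; refine sum_congr rfl fun i _ => ?_
      congr 1; ring
    rw [this]
    ring

/-- Convolution with `μ_T * μ_{-T}`. -/
noncomputable def opP (T : Finset (ZMod N)) (f : ZMod N → ℝ) (y : ZMod N) : ℝ :=
  (∑ p ∈ T ×ˢ T, f (y + p.1 - p.2)) / (T.card : ℝ) ^ 2

lemma opP_bound (T : Finset (ZMod N)) (hT : T.Nonempty) (f g : ZMod N → ℝ) (c : ℝ)
    (h : ∀ t ∈ T, ∀ s ∈ T, ∑ y, (f (y + t - s) - g y) ^ 4 ≤ c) :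
    ∑ y, (opP T f y - g y) ^ 4 ≤ c := by
  have hT0 : (0 : ℝ) < T.card := by simpa using hT.card_pos
  have e : ∀ y, (opP T f y - g y) ^ 4 ≤
      (∑ p ∈ T ×ˢ T, (f (y + p.1 - p.2) - g y) ^ 4) / (T.card : ℝ) ^ 2 := by
    intro y
    have h1 : opP T f y - g y = (∑ p ∈ T ×ˢ T, (f (y + p.1 - p.2) - g y)) / (T.card : ℝ) ^ 2 := by
      unfold opP
      rw [sum_sub_distrib, sum_const, card_product, nsmul_eq_mul]
      push_cast
      field_simp
    rw [h1, div_pow, div_le_div_iff₀ (by positivity) (by positivity)]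
    have := pow4_sum (T ×ˢ T) (fun p => f (y + p.1 - p.2) - g y)
    rw [card_product] at this
    push_cast at this
    calc _ ≤ _ * (T.card : ℝ) ^ 2 := mul_le_mul_of_nonneg_right this (by positivity)
      _ = _ := by ring
  calc _ ≤ ∑ y, (∑ p ∈ T ×ˢ T, (f (y + p.1 - p.2) - g y) ^ 4) / (T.card : ℝ) ^ 2 :=
        sum_le_sum fun y _ => e y
    _ = (∑ p ∈ T ×ˢ T, ∑ y, (f (y + p.1 - p.2) - g y) ^ 4) / (T.card : ℝ) ^ 2 := by
        rw [← sum_div, sum_comm]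
    _ ≤ (∑ p ∈ T ×ˢ T, c) / (T.card : ℝ) ^ 2 := by
        gcongr with p hp
        rw [mem_product] at hp
        exact h _ hp.1 _ hp.2
    _ = c := by
        rw [sum_const, card_product, nsmul_eq_mul]; push_cast; field_simp

lemma opP_sub (T : Finset (ZMod N)) (f g : ZMod N → ℝ) (y : ZMod N) :
    opP T f y - opP T g y = opP T (fun y => f y - g y) y := by
  unfold opP; rw [sum_sub_distrib, sub_div]

lemma opP_contract (T : Finset (ZMod N)) (hT : T.Nonempty) (f g : ZMod N → ℝ) :
    ∑ y, (opP T f y - opP T g y) ^ 4 ≤ ∑ y, (f y - g y) ^ 4 := by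
  have := opP_bound T hT (fun y => f y - g y) (fun _ => 0) (∑ y, (f y - g y) ^ 4) (by
    intro t _ s _
    simp only [sub_zero, add_sub_assoc]
    exact (sum_shift4 (fun y => (f y - g y) ^ 4) (t - s)).le)
  simpa only [opP_sub, sub_zero] using this

lemma opP_iter (T : Finset (ZMod N)) (hT : T.Nonempty) (F h : ZMod N → ℝ) (c : ℝ)
    (hc : ∀ t ∈ T, ∑ y, (F (y + t) - h y) ^ 4 ≤ c) (m : ℕ) :
    ∑ y, ((opP T)^[m] F y - F y) ^ 4 ≤ (m : ℝ) ^ 4 * (16 * c) := by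
  have h1 : ∑ y, (opP T F y - F y) ^ 4 ≤ 16 * c := by
    apply opP_bound T hT
    intro t ht s hs
    rw [← sum_shift4 _ s]
    calc _ ≤ ∑ y, 8 * ((F (y + t) - h y) ^ 4 + (F (y + s) - h y) ^ 4) := by
          refine sum_le_sum fun y _ => ?_
          rw [show y + s + t - s = y + t by ring]
          generalize F (y + t) = a
          generalize F (y + s) = b
          generalize h y = z
          have := pow4_sum (univ : Finset (Fin 2)) ![a - z, z - b]
          simp [Fin.sum_univ_two] at this
          have e : (z - b) ^ 4 = (b - z) ^ 4 := by ring
          rw [e] at this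
          linarith
      _ = 8 * (∑ y, (F (y + t) - h y) ^ 4 + ∑ y, (F (y + s) - h y) ^ 4) := by
          rw [← mul_sum, sum_add_distrib]
      _ ≤ _ := by linarith [hc t ht, hc s hs]
  have h2 : ∀ j : ℕ, ∑ y, ((opP T)^[j + 1] F y - (opP T)^[j] F y) ^ 4 ≤ 16 * c := by
    intro j
    induction j with
    | zero => simpa using h1
    | succ j ih =>
      rw [Function.iterate_succ_apply' _ (j + 1)]
      nth_rewrite 2 [Function.iterate_succ_apply' _ j]
      exact (opP_contract T hT _ _).trans ih
  calc _ = ∑ y, (∑ j ∈ range m, ((opP T)^[j + 1] F y - (opP T)^[j] F y)) ^ 4 := by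
        refine sum_congr rfl fun y _ => ?_
        rw [sum_range_sub (fun j => (opP T)^[j] F y)]; rfl
    _ ≤ ∑ y, (m : ℝ) ^ 3 * ∑ j ∈ range m, ((opP T)^[j + 1] F y - (opP T)^[j] F y) ^ 4 := by
        refine sum_le_sum fun y _ => ?_
        have := pow4_sum (range m) (fun j => (opP T)^[j + 1] F y - (opP T)^[j] F y)
        rwa [card_range] at this
    _ = (m : ℝ) ^ 3 * ∑ j ∈ range m, ∑ y, ((opP T)^[j + 1] F y - (opP T)^[j] F y) ^ 4 := by
        rw [← mul_sum, sum_comm]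
    _ ≤ (m : ℝ) ^ 3 * ∑ j ∈ range m, 16 * c := by
        gcongr with j _; exact h2 j
    _ = _ := by simp; ring

/-- Fourier multiplier of `opP T`. -/
noncomputable def wT (T : Finset (ZMod N)) (r : ZMod N) : ℝ :=
  (‖∑ t ∈ T, ec (r * t)‖ / T.card) ^ 2

lemma opP_fourier (T : Finset (ZMod N)) (f : ZMod N → ℝ) (c : ZMod N → ℂ)
    (h : ∀ y, (f y : ℂ) = ∑ r, c r * ec (-(r * y))) (y : ZMod N) :
    (opP T f y : ℂ) = ∑ r, (c r * wT T r) * ec (-(r * y)) := by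
  unfold opP wT
  push_cast
  simp only [h]
  rw [sum_comm, sum_div]
  refine sum_congr rfl fun r _ => ?_
  rw [div_pow, ← Complex.mul_conj', map_sum, sum_mul_sum, sum_product]
  have : ∀ t s, c r * ec (-(r * (y + t - s))) =
      c r * ec (-(r * y)) * (ec (r * s) * conj (ec (r * t))) := by
    intro t s
    rw [← ec_neg, ← ec_add, mul_assoc, ← ec_add]; congr 2; ring
  simp only [this, ← mul_sum]
  rw [sum_comm]
  simp only [← mul_sum]
  ring

lemma opP_iter_fourier (T : Finset (ZMod N)) (f : ZMod N → ℝ) (c : ZMod N → ℂ)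
    (h : ∀ y, (f y : ℂ) = ∑ r, c r * ec (-(r * y))) (m : ℕ) (y : ZMod N) :
    ((opP T)^[m] f y : ℂ) = ∑ r, (c r * (wT T r) ^ m) * ec (-(r * y)) := by
  induction m generalizing y with
  | zero => simpa using h y
  | succ m ih =>
    rw [Function.iterate_succ_apply', opP_fourier T _ _ ih]
    refine sum_congr rfl fun r _ => ?_
    rw [pow_succ]; ring

lemma fourier_diff (T B : Finset (ZMod N)) (F : ZMod N → ℝ) (m : ℕ) (x : ZMod N) (κ M : ℝ)
    (hκ : ∀ r, wT T r ^ m * ‖ec (r * x) - 1‖ ≤ κ) (hM0 : 0 ≤ M)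
    (hM : (∑ y, F y ^ 2) * B.card ≤ M ^ 2) :
    |∑ b ∈ B, (opP T)^[m] F (b + x) - ∑ b ∈ B, (opP T)^[m] F b| ≤ κ * M := by
  classical
  have hN : (N : ℝ) ≠ 0 := Nat.cast_ne_zero.2 (NeZero.ne N)
  set c : ZMod N → ℂ := fun r => (N : ℂ)⁻¹ * ∑ z, (F z : ℂ) * ec (r * z) with hc
  have hF : ∀ y, (F y : ℂ) = ∑ r, c r * ec (-(r * y)) := fun y => inversion (fun y => (F y : ℂ)) y
  have hit := opP_iter_fourier T F c hF m
  set β : ZMod N → ℂ := fun r => ∑ b ∈ B, ec (r * b) with hβ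
  have hκ0 : 0 ≤ κ := le_trans (mul_nonneg (pow_nonneg (sq_nonneg _) _) (norm_nonneg _)) (hκ 0)
  have hdiff : ((∑ b ∈ B, (opP T)^[m] F (b + x) - ∑ b ∈ B, (opP T)^[m] F b : ℝ) : ℂ) =
      ∑ r, c r * (wT T r) ^ m * conj (β r) * conj (ec (r * x) - 1) := by
    push_cast
    rw [← sum_sub_distrib]
    simp only [hit, ← sum_sub_distrib]
    rw [sum_comm]
    refine sum_congr rfl fun r _ => ?_
    simp only [hβ, map_sum, map_sub, map_one, mul_sum, sum_mul, ← ec_neg]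
    refine sum_congr rfl fun b _ => ?_
    rw [show -(r * (b + x)) = -(r * b) + -(r * x) by ring, ec_add]
    ring
  have hc2 : ∑ r, ‖c r‖ ^ 2 = (N : ℝ)⁻¹ * ∑ y, F y ^ 2 := by
    have := parseval (fun y => (F y : ℂ))
    have h1 : ∀ r, ‖c r‖ ^ 2 = ((N : ℝ)⁻¹) ^ 2 * ‖∑ y, (F y : ℂ) * ec (r * y)‖ ^ 2 := by
      intro r
      simp only [hc]
      rw [norm_mul, mul_pow]; simp
    rw [sum_congr rfl fun r _ => h1 r, ← mul_sum, this]
    simp only [Complex.norm_real, Real.norm_eq_abs, sq_abs]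
    field_simp
  have hβ2 : ∑ r, ‖β r‖ ^ 2 = N * B.card := by
    have := parseval (fun y => if y ∈ B then (1 : ℂ) else 0)
    simp only [ite_mul, one_mul, zero_mul, sum_ite_mem, univ_inter] at this
    simp only [hβ, this]
    congr 1
    have : ∀ y, ‖(if y ∈ B then (1 : ℂ) else 0)‖ ^ 2 = if y ∈ B then (1 : ℝ) else 0 := by
      intro y; split_ifs <;> simp
    simp only [this]; simp
  have hcs : ∑ r, ‖c r‖ * ‖β r‖ ≤ M := by
    refine abs_le_of_sq_le_sq' ?_ hM0 |>.2
    refine (sum_mul_sq_le_sq_mul_sq univ _ _).trans ?_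
    rw [hc2, hβ2]
    refine le_trans (le_of_eq ?_) hM
    rw [show ∀ a Z n b : ℝ, a * Z * (n * b) = (a * n) * (Z * b) by intros; ring, inv_mul_cancel₀ hN, one_mul]
  rw [← Real.norm_eq_abs, ← Complex.norm_real, hdiff]
  calc _ ≤ ∑ r, ‖c r * (wT T r) ^ m * conj (β r) * conj (ec (r * x) - 1)‖ := norm_sum_le _ _
    _ ≤ ∑ r, κ * (‖c r‖ * ‖β r‖) := by
        refine sum_le_sum fun r _ => ?_
        rw [norm_mul, norm_mul, norm_mul, Complex.norm_conj, Complex.norm_conj, norm_pow,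
          Complex.norm_real, Real.norm_of_nonneg (show 0 ≤ wT T r from sq_nonneg _)]
        calc _ = (wT T r ^ m * ‖ec (r * x) - 1‖) * (‖c r‖ * ‖β r‖) := by ring
          _ ≤ _ := by gcongr; exact hκ r
    _ ≤ _ := by rw [← mul_sum]; gcongr

end cs
section final
variable {N : ℕ} [NeZero N]

lemma wT_le_one (T : Finset (ZMod N)) (r : ZMod N) : wT T r ≤ 1 := by
  unfold wT
  refine pow_le_one₀ (by positivity) (div_le_one_of_le₀ ?_ (Nat.cast_nonneg _))
  refine (norm_sum_le _ _).trans ?_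
  simp [ec_norm]

lemma core (A B : Finset (ZMod N)) (K : ℝ) (hA : A.Nonempty) (hB : B.Nonempty) (hK : 1 ≤ K)
    (hAB : ((A + B).card : ℝ) ≤ K * B.card) (k m : ℕ) (hk : 0 < k)
    (hkm : 24576 * (m : ℝ) ^ 4 * K ≤ (k : ℝ) ^ 2) (hm : 8 * K ≤ (4 : ℝ) ^ m) :
    ∃ Λ : Finset (ZMod N), (Λ.card : ℝ) ≤ 8 * (1 + k * Real.log ((A.card : ℝ) / N)⁻¹) ∧
      ∀ ε : ℝ, 0 ≤ ε → Λ.card * (2 * Real.pi * ε) ≤ 1 / (4 * K) →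
        bohr N Λ ε ⊆ (A - A) + (B - B) := by
  classical
  have hA0 : (0 : ℝ) < A.card := by simpa using hA.card_pos
  have hB0 : (0 : ℝ) < B.card := by simpa using hB.card_pos
  have hN0 : (0 : ℝ) < N := Nat.cast_pos.2 (Nat.pos_of_ne_zero (NeZero.ne N))
  have hk0 : (0 : ℝ) < k := by exact_mod_cast hk
  have hK0 : 0 < K := by linarith
  set S := A + B with hSdef
  have hS : S.Nonempty := hA.add hB
  obtain ⟨T, h, hTc, hTh⟩ := croot_sisask A S hA hS k hk
  have hT0 : (0 : ℝ) < T.card := by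
    by_contra hcon
    have h1 : (0 : ℝ) < N * (A.card : ℝ) ^ k := by positivity
    have h2 : (T.card : ℝ) = 0 := le_antisymm (not_lt.1 hcon) (Nat.cast_nonneg _)
    rw [h2] at hTc
    linarith
  have hT : T.Nonempty := by
    rw [← card_pos]; exact_mod_cast hT0
  set Spec : Finset (ZMod N) := univ.filter fun r => (T.card : ℝ) / 2 ≤ ‖∑ t ∈ T, ec (r * t)‖
    with hSpec
  set L := Real.log ((A.card : ℝ) / N)⁻¹ with hL
  have hd : ∀ s', s' ⊆ Spec → AddDissociated (s' : Set (ZMod N)) →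
      s'.card ≤ ⌊8 * (1 + k * L)⌋₊ := by
    intro s' hs' hdis
    apply Nat.le_floor
    have hch := chang T s' hdis (fun r hr => by
      have := hs' hr
      rw [hSpec, mem_filter] at this
      exact this.2)
    have h1 : Real.exp (s'.card / 8) ≤ 2 * (((A.card : ℝ) / N)⁻¹) ^ k := by
      rw [inv_div, div_pow, ← mul_div_assoc, le_div_iff₀ (by positivity)]
      refine le_of_mul_le_mul_left ?_ hT0
      calc _ = (T.card * Real.exp (s'.card / 8)) * (A.card : ℝ) ^ k := by ring
        _ ≤ N * (A.card : ℝ) ^ k := by gcongr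
        _ ≤ _ := by linarith
    have h2 := Real.log_le_log (Real.exp_pos _) h1
    rw [Real.log_exp, Real.log_mul (by norm_num) (by positivity), Real.log_pow] at h2
    have h3 : Real.log 2 ≤ 1 := by
      have := Real.log_le_sub_one_of_pos (show (0 : ℝ) < 2 by norm_num); linarith
    linarith
  have hLn : 0 ≤ L := by
    apply Real.log_nonneg
    rw [inv_div, le_div_iff₀ hA0, one_mul]
    have := card_le_univ A
    rw [ZMod.card] at this
    exact_mod_cast this
  obtain ⟨Λ, -, hΛc, hΛs⟩ := exists_subset_addSpan_card_le_of_forall_addDissociated hd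
  refine ⟨Λ, ?_, ?_⟩
  · exact (Nat.cast_le.2 hΛc).trans (Nat.floor_le (by positivity))
  intro ε hε hεK x hx
  set F := avF A S with hF
  set H := (opP T)^[m] F with hH
  have hκ : ∀ r, wT T r ^ m * ‖ec (r * x) - 1‖ ≤ 1 / (4 * K) := by
    intro r
    have hw0 : 0 ≤ wT T r := sq_nonneg _
    by_cases hr : r ∈ Spec
    · have := bohr_span Λ ε hε x hx r (hΛs hr)
      calc _ ≤ 1 * ‖ec (r * x) - 1‖ := by
            gcongr; exact pow_le_one₀ hw0 (wT_le_one T r)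
        _ ≤ _ := by linarith
    · rw [hSpec, mem_filter] at hr
      have hr' : ‖∑ t ∈ T, ec (r * t)‖ < (T.card : ℝ) / 2 := by
        by_contra hcon; exact hr ⟨mem_univ _, not_lt.1 hcon⟩
      have hw : wT T r ≤ 1 / 4 := by
        unfold wT
        have : ‖∑ t ∈ T, ec (r * t)‖ / T.card ≤ 1 / 2 := by
          rw [div_le_iff₀ hT0]; linarith
        calc _ ≤ (1 / 2 : ℝ) ^ 2 := by gcongr
          _ = _ := by norm_num
      have h2 : ‖ec (r * x) - 1‖ ≤ 2 := by
        refine (norm_sub_le _ _).trans ?_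
        rw [ec_norm]; norm_num
      calc _ ≤ (1 / 4 : ℝ) ^ m * 2 := by gcongr
        _ = 2 / 4 ^ m := by rw [div_pow, one_pow]; ring
        _ ≤ 2 / (8 * K) := by gcongr
        _ = _ := by field_simp; norm_num
  have hfd := fourier_diff T B F m x (1 / (4 * K)) (K * B.card) hκ (by positivity) (by
    have h1 : ∑ y, F y ^ 2 ≤ K * B.card := (avF_sq_sum A S hA).trans hAB
    calc _ ≤ K * B.card * B.card := by gcongr
      _ ≤ K * B.card * (K * B.card) := by
          gcongr
          exact le_mul_of_one_le_left hB0.le hK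
      _ = _ := by ring)
  have hfd' : |∑ b ∈ B, H (b + x) - ∑ b ∈ B, H b| ≤ B.card / 4 := by
    refine hfd.trans (le_of_eq ?_); field_simp
  have hHF4 := opP_iter T hT F h _ hTh m
  have happ : ∀ z : ZMod N, |∑ b ∈ B, H (b + z) - ∑ b ∈ B, F (b + z)| ≤ B.card / 4 := by
    intro z
    rw [← sum_sub_distrib]
    set s := ∑ b ∈ B, (H (b + z) - F (b + z)) with hs
    have h1 : s ^ 4 ≤ (B.card / 4 : ℝ) ^ 4 := by
      calc s ^ 4 ≤ (B.card : ℝ) ^ 3 * ∑ b ∈ B, (H (b + z) - F (b + z)) ^ 4 := pow4_sum _ _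
        _ ≤ (B.card : ℝ) ^ 3 * ∑ b, (H (b + z) - F (b + z)) ^ 4 := by
            refine mul_le_mul_of_nonneg_left ?_ (by positivity)
            exact sum_le_sum_of_subset_of_nonneg (subset_univ _) fun v _ _ => by positivity
        _ = (B.card : ℝ) ^ 3 * ∑ b, (H b - F b) ^ 4 := by
            rw [sum_shift4 (fun b => (H b - F b) ^ 4)]
        _ ≤ (B.card : ℝ) ^ 3 * ((m : ℝ) ^ 4 * (16 * (6 * S.card / k ^ 2))) := by gcongr
        _ ≤ (B.card : ℝ) ^ 3 * ((m : ℝ) ^ 4 * (16 * (6 * (K * B.card) / k ^ 2))) := by gcongr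
        _ = (B.card : ℝ) ^ 4 * ((96 * m ^ 4 * K) / k ^ 2) := by ring
        _ ≤ (B.card : ℝ) ^ 4 * (1 / 256) := by
            refine mul_le_mul_of_nonneg_left ?_ (by positivity)
            rw [div_le_iff₀ (by positivity)]
            linarith
        _ = _ := by ring
    have h2 : |s| ^ 4 ≤ (B.card / 4 : ℝ) ^ 4 := by rwa [Even.pow_abs (by decide)]
    exact le_of_pow_le_pow_left₀ (by norm_num) (by positivity) h2
  have hFB : ∑ b ∈ B, F (b + 0) = B.card := by
    have : ∀ b ∈ B, F (b + 0) = 1 := by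
      intro b hb
      simp only [hF, avF, add_zero]
      have : ∀ a ∈ A, ind S (b + a) = 1 := by
        intro a ha
        unfold ind
        rw [if_pos]
        rw [add_comm]; exact add_mem_add ha hb
      rw [sum_congr rfl this]
      simp [hA.ne_empty]
    rw [sum_congr rfl this]; simp
  have h0 := happ 0
  rw [hFB] at h0
  simp only [add_zero] at h0
  have hx1 := happ x
  have hpos : 0 < ∑ b ∈ B, F (b + x) := by
    rw [abs_le] at h0 hx1 hfd'
    linarith [h0.1, hx1.2, hfd'.1]
  obtain ⟨b, hb, hbF⟩ := exists_lt_of_sum_lt (s := B) (f := fun _ => (0 : ℝ)) (by simpa using hpos)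
  have hbF' : 0 < ∑ a ∈ A, ind S (b + x + a) := by
    by_contra hcon
    have : F (b + x) ≤ 0 := div_nonpos_of_nonpos_of_nonneg (not_lt.1 hcon) hA0.le
    linarith
  obtain ⟨a, ha, haF⟩ := exists_lt_of_sum_lt (s := A) (f := fun _ => (0 : ℝ)) (by simpa using hbF')
  have hmem : b + x + a ∈ S := by
    by_contra hcon
    simp [ind, hcon] at haF
  rw [hSdef, mem_add] at hmem
  obtain ⟨a', ha', b', hb', hab⟩ := hmem
  rw [mem_add]
  refine ⟨a' - a, sub_mem_sub ha' ha, b' - b, sub_mem_sub hb' hb, ?_⟩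
  linear_combination hab

end final

/-- **The main refinement (Theorem 1.3).** There is an absolute constant `C > 0` such that: if
`A, B ⊆ ℤ/Nℤ` are nonempty with `|A + B| ≤ K|B|` (`K ≥ 1`) and `A` has density `α = |A|/N`,
then `(A-A)+(B-B)` contains an intersection of Bohr sets `B(Γ,δ) ∩ B(Λ,ε)` with
`|Γ| ≤ C K^{1/2}(1 + log α⁻¹)`, `log δ⁻¹ ≤ C K^{1/4}(1 + log α⁻¹)(1 + log(Kα⁻¹))`,
`|Λ| ≤ C K^{3/4}(1 + log α⁻¹)` and `log ε⁻¹ ≤ C(1 + log(K(1 + log α⁻¹)))`. -/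
theorem main_refinement :
    ∃ C : ℝ, 0 < C ∧
      ∀ (N : ℕ) [NeZero N] (A B : Finset (ZMod N)) (K : ℝ) (α : ℝ),
        A.Nonempty → B.Nonempty → 1 ≤ K →
        ((A + B).card : ℝ) ≤ K * B.card →
        α = (A.card : ℝ) / N →
        ∃ (Γ Λ : Finset (ZMod N)) (δ ε : ℝ),
          0 < δ ∧ δ ≤ 1 ∧ 0 < ε ∧ ε ≤ 1 ∧
          bohr N Γ δ ∩ bohr N Λ ε ⊆ (A - A) + (B - B) ∧
          (Γ.card : ℝ) ≤ C * K ^ ((1 : ℝ) / 2) * (1 + Real.log α⁻¹) ∧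
          Real.log δ⁻¹ ≤ C * K ^ ((1 : ℝ) / 4) * (1 + Real.log α⁻¹) * (1 + Real.log (K * α⁻¹)) ∧
          (Λ.card : ℝ) ≤ C * K ^ ((3 : ℝ) / 4) * (1 + Real.log α⁻¹) ∧
          Real.log ε⁻¹ ≤ C * (1 + Real.log (K * (1 + Real.log α⁻¹))) := by
  refine ⟨10 ^ 9, by norm_num, ?_⟩
  intro N _ A B K α hA hB hK hAB hα
  have hA0 : (0 : ℝ) < A.card := by simpa using hA.card_pos
  have hN0 : (0 : ℝ) < N := Nat.cast_pos.2 (Nat.pos_of_ne_zero (NeZero.ne N))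
  have hK0 : 0 < K := by linarith
  have hα0 : 0 < α := by rw [hα]; positivity
  have hα1 : 1 ≤ α⁻¹ := by
    rw [hα, inv_div, le_div_iff₀ hA0, one_mul]
    have := card_le_univ A
    rw [ZMod.card] at this
    exact_mod_cast this
  set L := Real.log α⁻¹ with hL
  have hL0 : 0 ≤ L := Real.log_nonneg hα1
  set p : ℝ := K ^ ((1 : ℝ) / 8) with hp
  have hp1 : 1 ≤ p := Real.one_le_rpow hK (by norm_num)
  have hp8 : p ^ 8 = K := by
    rw [hp, ← Real.rpow_natCast, ← Real.rpow_mul hK0.le]; norm_num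
  have hp6 : K ^ ((3 : ℝ) / 4) = p ^ 6 := by
    rw [hp, ← Real.rpow_natCast, ← Real.rpow_mul hK0.le]; norm_num
  set u : ℕ := ⌈p⌉₊ with hu
  have hpu : p ≤ u := Nat.le_ceil p
  have hu2 : (u : ℝ) ≤ 2 * p := by
    have := Nat.ceil_lt_add_one (show 0 ≤ p by linarith)
    linarith
  have hu1 : (1 : ℝ) ≤ u := hp1.trans hpu
  have hKu : K ≤ (u : ℝ) ^ 8 := by rw [← hp8]; gcongr
  have hupos : 0 < u := by exact_mod_cast (by linarith : (0 : ℝ) < u)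
  obtain ⟨Λ, hΛc, hΛ⟩ := core A B K hA hB hK hAB (15700 * u ^ 6) (10 * u) (by positivity)
    (by
      push_cast
      calc 24576 * (10 * (u : ℝ)) ^ 4 * K ≤ 24576 * (10 * (u : ℝ)) ^ 4 * (u : ℝ) ^ 8 := by gcongr
        _ = 245760000 * (u : ℝ) ^ 12 := by ring
        _ ≤ 246490000 * (u : ℝ) ^ 12 := by gcongr; norm_num
        _ = _ := by ring)
    (by
      have h4 : (u : ℝ) ≤ 4 ^ u := by
        exact_mod_cast (Nat.lt_pow_self (by norm_num : 1 < 4)).le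
      have h4' : (4 : ℝ) ≤ 4 ^ u := by
        calc (4 : ℝ) = 4 ^ 1 := by norm_num
          _ ≤ 4 ^ u := pow_le_pow_right₀ (by norm_num) hupos
      calc 8 * K ≤ 4 ^ 2 * (u : ℝ) ^ 8 := by linarith
        _ ≤ (4 ^ u) ^ 2 * (4 ^ u) ^ 8 := by gcongr
        _ = _ := by rw [← pow_add, ← pow_mul]; congr 1; ring)
  rw [← hα, ← hL] at hΛc
  push_cast at hΛc
  have hp61 : 1 ≤ p ^ 6 := one_le_pow₀ hp1
  have hu6 : (u : ℝ) ^ 6 ≤ 64 * p ^ 6 := by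
    calc (u : ℝ) ^ 6 ≤ (2 * p) ^ 6 := by gcongr
      _ = _ := by ring
  have hΛ6 : (Λ.card : ℝ) ≤ 8038400 * p ^ 6 * (1 + L) := by
    have h1 : 15700 * (u : ℝ) ^ 6 * L ≤ 15700 * (64 * p ^ 6) * L := by gcongr
    nlinarith
  have hpK : p ^ 6 ≤ K := by
    rw [← hp8]; exact pow_le_pow_right₀ hp1 (by norm_num)
  have hcard0 : (0 : ℝ) ≤ Λ.card := Nat.cast_nonneg _
  have hinv : (1 / (32 * K * (Λ.card + 1)) : ℝ)⁻¹ = 32 * K * (Λ.card + 1) := by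
    rw [one_div, inv_inv]
  have hbig : 1 ≤ 32 * K * ((Λ.card : ℝ) + 1) := by nlinarith
  have hKL : 1 ≤ K * (1 + L) := by nlinarith
  refine ⟨∅, Λ, 1, 1 / (32 * K * (Λ.card + 1)), one_pos, le_refl _, by positivity, ?_, ?_, ?_,
    ?_, ?_, ?_⟩
  · rw [div_le_one (by positivity)]; exact hbig
  · refine inter_subset_right.trans (hΛ _ (by positivity) ?_)
    have h7 : 2 * Real.pi ≤ 8 := by linarith [Real.pi_le_four]
    rw [← mul_assoc, mul_one_div, div_le_div_iff₀ (by positivity) (by positivity)]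
    calc (Λ.card : ℝ) * (2 * Real.pi) * (4 * K) ≤ Λ.card * 8 * (4 * K) := by gcongr
      _ ≤ _ := by nlinarith
  · simp only [card_empty, Nat.cast_zero]; positivity
  · rw [inv_one, Real.log_one]
    have : 0 ≤ Real.log (K * α⁻¹) := Real.log_nonneg (by nlinarith)
    positivity
  · rw [hp6]
    refine hΛ6.trans ?_
    gcongr
    norm_num
  · rw [hinv]
    have h1 : 32 * K * ((Λ.card : ℝ) + 1) ≤ 300000000 * (K * (1 + L)) ^ 2 := by
      have h2 : (Λ.card : ℝ) + 1 ≤ 9000000 * (K * (1 + L)) := by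
        have : p ^ 6 * (1 + L) ≤ K * (1 + L) := by gcongr
        nlinarith
      calc 32 * K * ((Λ.card : ℝ) + 1) ≤ 32 * (K * (1 + L)) * (9000000 * (K * (1 + L))) := by
            gcongr
            nlinarith
        _ ≤ _ := by nlinarith
    have h3 := Real.log_le_log (by linarith) h1
    have h6 : Real.log (300000000 * (K * (1 + L)) ^ 2) =
        Real.log 300000000 + 2 * Real.log (K * (1 + L)) := by
      rw [Real.log_mul (by norm_num) (by positivity), Real.log_pow]; norm_num
    rw [h6] at h3
    have h4 := Real.log_le_sub_one_of_pos (show (0 : ℝ) < 300000000 by norm_num)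
    have h5 : 0 ≤ Real.log (K * (1 + L)) := Real.log_nonneg hKL
    linarith
end

section
/- Let N be a positive integer, Γ ⊆ ℤ/Nℤ a finite set of frequencies and δ ∈ (0,1/2]. Then there exists δ' with δ ≤ δ' < 2δ such that the Bohr set B(Γ,δ') is regular. -/
open Finset Complex
open scoped Pointwise BigOperators ComplexConjugate

lemma reg_cover (f : ℝ → ℝ) (hf : Monotone f) (hr : ∀ x, ∃ ε > 0, f (x + ε) = f x)
    (L U K x0 x1 : ℝ) (hL : ∀ x, L ≤ f x) (hU : ∀ x, f x ≤ U) (hK : 0 < K) (h01 : x0 ≤ x1)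
    (hT : 2 * (U - L) < K * (x1 - x0)) :
    ∃ x, x0 ≤ x ∧ x ≤ x1 ∧ ∀ y, |f y - f x| ≤ K * |y - x| := by
  by_contra hcon
  push Not at hcon
  set F : ℝ → ℝ := fun x => ⨆ y, (f y - K * |y - x|) with hF
  set E : ℝ → ℝ := fun x => ⨅ y, (f y + K * |y - x|) with hE
  have bF : ∀ x, BddAbove (Set.range fun y => f y - K * |y - x|) := by
    intro x
    refine ⟨U, ?_⟩
    rintro _ ⟨y, rfl⟩
    have := hU y
    have : 0 ≤ K * |y - x| := by positivity
    simp only; linarith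
  have bE : ∀ x, BddBelow (Set.range fun y => f y + K * |y - x|) := by
    intro x
    refine ⟨L, ?_⟩
    rintro _ ⟨y, rfl⟩
    have := hL y
    have : 0 ≤ K * |y - x| := by positivity
    simp only; linarith
  have leF : ∀ x y, f y - K * |y - x| ≤ F x := fun x y => le_ciSup (bF x) y
  have Ele : ∀ x y, E x ≤ f y + K * |y - x| := fun x y => ciInf_le (bE x) y
  have Fle : ∀ x c, (∀ y, f y - K * |y - x| ≤ c) → F x ≤ c := fun x c h => ciSup_le h
  have leE : ∀ x c, (∀ y, c ≤ f y + K * |y - x|) → c ≤ E x := fun x c h => le_ciInf h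
  have FU : ∀ x, F x ≤ U := fun x => Fle _ _ fun y => by
    have := hU y
    have : 0 ≤ K * |y - x| := by positivity
    linarith
  have LF : ∀ x, L ≤ F x := fun x => by
    have := leF x x
    simp at this
    linarith [hL x]
  have LE : ∀ x, L ≤ E x := fun x => leE _ _ fun y => by
    have := hL y
    have : 0 ≤ K * |y - x| := by positivity
    linarith
  have EU : ∀ x, E x ≤ U := fun x => by
    have := Ele x x
    simp at this
    linarith [hU x]
  have tri : ∀ x x' y : ℝ, K * |y - x'| ≤ K * |y - x| + K * |x - x'| := by
    intro x x' y
    rw [← mul_add]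
    exact mul_le_mul_of_nonneg_left (abs_sub_le y x x') hK.le
  have cF : Continuous F := by
    apply LipschitzWith.continuous (K := K.toNNReal)
    apply LipschitzWith.of_le_add_mul
    intro x x'
    rw [Real.coe_toNNReal _ hK.le, Real.dist_eq]
    apply Fle
    intro y
    have := leF x' y
    have := tri x x' y
    linarith
  have cE : Continuous E := by
    apply LipschitzWith.continuous (K := K.toNNReal)
    apply LipschitzWith.of_le_add_mul
    intro x x'
    rw [Real.coe_toNNReal _ hK.le, Real.dist_eq]
    rw [← sub_le_iff_le_add]
    apply leE
    intro y
    have := Ele x y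
    have := tri x' x y
    rw [abs_sub_comm x' x] at this
    linarith
  have mF : ∀ x e, 0 ≤ e → F x ≤ F (x + e) := by
    intro x e he
    apply Fle
    intro y
    have h1 := leF (x + e) (y + e)
    rw [add_sub_add_right_eq_sub] at h1
    have := hf (show y ≤ y + e by linarith)
    linarith
  have mE : ∀ x e, 0 ≤ e → E x ≤ E (x + e) := by
    intro x e he
    apply leE
    intro y
    have h1 := Ele x (y - e)
    rw [show y - e - x = y - (x + e) by ring] at h1
    have := hf (show y - e ≤ y by linarith)
    linarith
  have step : ∀ x, x0 ≤ x → x ≤ x1 → ∃ e0 > 0, ∀ e, 0 ≤ e → e ≤ e0 →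
      F x + E x + K * e ≤ F (x + e) + E (x + e) := by
    intro x hx0 hx1
    obtain ⟨y, hy⟩ := hcon x hx0 hx1
    rcases le_total x y with hxy | hxy
    · rw [abs_of_nonneg (sub_nonneg.2 (hf hxy)), abs_of_nonneg (sub_nonneg.2 hxy)] at hy
      have hlt : x < y := by
        rcases hxy.lt_or_eq with h | h
        · exact h
        · subst h; simp at hy
      obtain ⟨e1, he1, hfe⟩ := hr x
      refine ⟨min e1 (y - x), lt_min he1 (by linarith), fun e he hee => ?_⟩
      have hee1 := le_trans hee (min_le_left _ _)
      have hee2 := le_trans hee (min_le_right _ _)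
      have h1 : f (x + e) ≤ f x := hfe ▸ hf (by linarith)
      have h2 : F x ≤ F (x + e) - K * e := by
        apply Fle
        intro z
        rcases le_total (x + e) z with hz | hz
        · have := leF (x + e) z
          rw [abs_of_nonneg (by linarith)] at this ⊢
          nlinarith
        · have h3 := leF (x + e) y
          rw [abs_of_nonneg (by linarith)] at h3
          have h4 := hf hz
          have : 0 ≤ K * |z - x| := by positivity
          nlinarith
      linarith [mE x e he]
    · rw [abs_of_nonpos (sub_nonpos.2 (hf hxy)), abs_of_nonpos (sub_nonpos.2 hxy)] at hy
      refine ⟨(f x - f y - K * (x - y)) / K, div_pos (by linarith) hK, fun e he hee => ?_⟩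
      rw [le_div_iff₀ hK] at hee
      have h2 : E x + K * e ≤ E (x + e) := by
        apply leE
        intro z
        rcases le_total z x with hz | hz
        · have := Ele x z
          rw [abs_of_nonpos (by linarith)] at this ⊢
          nlinarith
        · have h3 := Ele x y
          rw [abs_of_nonpos (by linarith)] at h3
          have h4 := hf hz
          have : 0 ≤ K * |z - (x + e)| := by positivity
          nlinarith
      linarith [mF x e he]
  have key : Set.Icc x0 x1 ⊆ {x | F x0 + E x0 + K * (x - x0) ≤ F x + E x} := by
    apply IsClosed.Icc_subset_of_forall_exists_gt
    · apply IsClosed.inter _ isClosed_Icc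
      exact isClosed_le (by fun_prop) (by fun_prop)
    · simp
    · rintro x ⟨hx, hx0, hx1⟩ y hy
      obtain ⟨e0, he0, h⟩ := step x hx0 hx1.le
      have hy' : x < y := hy
      have hm : 0 < min e0 (y - x) := lt_min he0 (by linarith)
      refine ⟨x + min e0 (y - x), ?_, ?_, ?_⟩
      · have := h _ hm.le (min_le_left _ _)
        simp only [Set.mem_ofPred_eq] at hx ⊢
        linarith
      · linarith
      · linarith [min_le_right e0 (y - x)]
  have := key (Set.right_mem_Icc.2 h01)
  simp only [Set.mem_ofPred_eq] at this
  linarith [FU x1, EU x1, LF x0, LE x0]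

lemma mem_bohr_iff (N : ℕ) [NeZero N] (Γ : Finset (ZMod N)) (δ : ℝ) (x : ZMod N) :
    x ∈ bohr N Γ δ ↔ ∀ t ∈ Γ, nint (((t * x).val : ℝ) / N) ≤ δ := by
  simp [bohr]

lemma bohr_mono (N : ℕ) [NeZero N] (Γ : Finset (ZMod N)) {a b : ℝ} (h : a ≤ b) :
    bohr N Γ a ⊆ bohr N Γ b := by
  intro x hx
  rw [mem_bohr_iff] at *
  exact fun t ht => (hx t ht).trans h

lemma bohr_pos (N : ℕ) [NeZero N] (Γ : Finset (ZMod N)) {a : ℝ} (h : 0 ≤ a) :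
    0 < (bohr N Γ a).card := by
  apply Finset.card_pos.2
  refine ⟨0, ?_⟩
  rw [mem_bohr_iff]
  intro t _
  simpa [nint] using h

lemma bohr_right (N : ℕ) [NeZero N] (Γ : Finset (ZMod N)) (a : ℝ) :
    ∃ ε > 0, bohr N Γ (a + ε) ⊆ bohr N Γ a := by
  have h : ∀ᶠ s in nhdsWithin a (Set.Ioi a), ∀ x : ZMod N, x ∈ bohr N Γ s → x ∈ bohr N Γ a := by
    rw [Filter.eventually_all]
    intro x
    by_cases hx : x ∈ bohr N Γ a
    · exact Filter.Eventually.of_forall fun s _ => hx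
    · have hx' := hx
      rw [mem_bohr_iff] at hx'
      push Not at hx'
      obtain ⟨t, ht, hlt⟩ := hx'
      filter_upwards [nhdsWithin_le_nhds (Iio_mem_nhds hlt)] with s hs hxs
      rw [mem_bohr_iff] at hxs
      exact absurd (hxs t ht) (not_le.2 hs)
  obtain ⟨s, hs, hs'⟩ := (h.and self_mem_nhdsWithin).exists
  have hs'' : a < s := hs'
  refine ⟨s - a, by linarith, ?_⟩
  rw [add_sub_cancel]
  exact fun x hx => hs x hx

noncomputable def bcol (θ δ : ℝ) : Fin 4 :=
  if θ < -δ then 0 else if θ < 0 then 1 else if θ < δ then 2 else 3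

lemma bcol_close {a b δ : ℝ} (ha : |a| ≤ 2 * δ) (hb : |b| ≤ 2 * δ)
    (h : bcol a δ = bcol b δ) : |a - b| ≤ δ := by
  rw [abs_le] at *
  unfold bcol at h
  split_ifs at h <;> first | (exfalso; revert h; decide) | (constructor <;> linarith)

lemma nint_diff (N : ℕ) [NeZero N] (t x y : ZMod N) (p q : ℤ) :
    nint (((t * (x - y)).val : ℝ) / N) ≤
      |(((t * x).val : ℝ) / N - p) - (((t * y).val : ℝ) / N - q)| := by
  have h : (((t * (x - y)).val : ℤ) : ZMod N) = (((t * x).val - (t * y).val : ℤ) : ZMod N) := by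
    push_cast
    simp [mul_sub]
  rw [ZMod.intCast_eq_intCast_iff_dvd_sub] at h
  obtain ⟨k, hk⟩ := h
  have hk' : ((t * x).val : ℝ) - (t * y).val - (t * (x - y)).val = N * k := by exact_mod_cast hk
  have hN : (N : ℝ) ≠ 0 := by exact_mod_cast NeZero.ne N
  have h2 : ((t * (x - y)).val : ℝ) / N = ((t * x).val : ℝ) / N - ((t * y).val : ℝ) / N - k := by
    field_simp
    linarith
  unfold nint
  refine (round_le _ (p - q - k)).trans (le_of_eq ?_)
  rw [h2]
  push_cast
  congr 1
  ring

lemma bohr_double (N : ℕ) [NeZero N] (Γ : Finset (ZMod N)) (δ : ℝ) :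
    (bohr N Γ (2 * δ)).card ≤ (bohr N Γ δ).card * 4 ^ Γ.card := by
  classical
  let θ : ZMod N → ZMod N → ℝ := fun t x =>
    ((t * x).val : ℝ) / N - round (((t * x).val : ℝ) / N)
  let c : ZMod N → (Γ → Fin 4) := fun x t => bcol (θ t x) δ
  have h1 : (bohr N Γ (2 * δ)).card ≤ (bohr N Γ δ).card * ((bohr N Γ (2 * δ)).image c).card := by
    apply Finset.card_le_mul_card_image
    intro b hb
    obtain ⟨y, hy, rfl⟩ := Finset.mem_image.1 hb
    apply Finset.card_le_card_of_injOn (fun x => x - y)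
    · intro x hx
      simp only [Finset.coe_filter, Set.mem_ofPred_eq] at hx
      simp only [SetLike.mem_coe]
      rw [mem_bohr_iff] at hy ⊢
      intro t ht
      refine (nint_diff N t x y (round (((t * x).val : ℝ) / N))
        (round (((t * y).val : ℝ) / N))).trans ?_
      exact bcol_close ((mem_bohr_iff _ _ _ _).1 hx.1 t ht) (hy t ht) (congrFun hx.2 ⟨t, ht⟩)
    · intro a _ b _ hab
      simpa using hab
  refine h1.trans (Nat.mul_le_mul_left _ ?_)
  refine (Finset.card_le_univ _).trans ?_
  simp

/-- **Regular value.** For any finite set of frequencies `Γ ⊆ ℤ/Nℤ` and `δ ∈ (0, 1/2]` there is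
`δ'` with `δ ≤ δ' < 2δ` such that the Bohr set `B(Γ, δ')` is regular. -/
theorem exists_regular_bohr (N : ℕ) [NeZero N] (Γ : Finset (ZMod N)) (δ : ℝ)
    (hδ0 : 0 < δ) (hδ1 : δ ≤ 1 / 2) :
    ∃ δ' : ℝ, δ ≤ δ' ∧ δ' < 2 * δ ∧ BohrRegular N Γ δ' := by
  rcases Γ.eq_empty_or_nonempty with rfl | hne
  · refine ⟨δ, le_rfl, by linarith, ?_⟩
    intro η _
    simp [bohr]
  have hd : (1 : ℝ) ≤ Γ.card := by exact_mod_cast hne.card_pos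
  set d : ℝ := (Γ.card : ℝ) with hd_def
  have hl2 : 0 < Real.log 2 := Real.log_pos (by norm_num)
  let cl : ℝ → ℝ := fun s => max δ (min s (2 * δ))
  have clm : Monotone cl := fun a b h => max_le_max le_rfl (min_le_min h le_rfl)
  have clδ : ∀ s, δ ≤ cl s := fun s => le_max_left _ _
  have cl2 : ∀ s, cl s ≤ 2 * δ := fun s => max_le (by linarith) (min_le_right _ _)
  have cle : ∀ s, δ ≤ s → s ≤ 2 * δ → cl s = s := fun s h1 h2 => by
    simp only [cl]; rw [min_eq_left h2, max_eq_right h1]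
  have cpos : ∀ a, δ ≤ a → (0 : ℝ) < (bohr N Γ a).card := fun a h => by
    exact_mod_cast bohr_pos N Γ (hδ0.le.trans h)
  have lmono : ∀ a b, δ ≤ a → a ≤ b →
      Real.log (bohr N Γ a).card ≤ Real.log (bohr N Γ b).card := fun a b h1 h2 =>
    Real.log_le_log (cpos a h1) (by exact_mod_cast Finset.card_le_card (bohr_mono N Γ h2))
  let f : ℝ → ℝ := fun s => Real.log (bohr N Γ (cl s)).card
  have hf : Monotone f := fun a b h => lmono _ _ (clδ a) (clm h)
  have hr : ∀ x, ∃ ε > 0, f (x + ε) = f x := by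
    intro x
    obtain ⟨ε, hε, hs⟩ := bohr_right N Γ (cl x)
    refine ⟨ε, hε, le_antisymm ?_ (hf (by linarith))⟩
    have h1 : cl (x + ε) ≤ cl x + ε := by
      apply max_le
      · linarith [clδ x]
      · have : min x (2 * δ) ≤ cl x := le_max_right _ _
        rcases min_cases x (2 * δ) with h | h <;> rcases min_cases (x + ε) (2 * δ) with h' | h' <;>
          linarith
    exact Real.log_le_log (cpos _ (clδ _))
      (by exact_mod_cast Finset.card_le_card ((bohr_mono N Γ h1).trans hs))
  have hdbl : Real.log (bohr N Γ (2 * δ)).card ≤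
      Real.log (bohr N Γ δ).card + d * (2 * Real.log 2) := by
    have h := bohr_double N Γ δ
    have h' : ((bohr N Γ (2 * δ)).card : ℝ) ≤ (bohr N Γ δ).card * 4 ^ Γ.card := by exact_mod_cast h
    have h2 := Real.log_le_log (cpos _ (by linarith)) h'
    rw [Real.log_mul (cpos _ le_rfl).ne' (by positivity), Real.log_pow,
      show (4 : ℝ) = 2 ^ 2 by norm_num, Real.log_pow] at h2
    exact_mod_cast h2
  have hdl : 0 < d * Real.log 2 := by positivity
  obtain ⟨x, hx0, hx1, hx⟩ := reg_cover f hf hr (Real.log (bohr N Γ δ).card)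
    (Real.log (bohr N Γ (2 * δ)).card) (8 * d * Real.log 2 / δ) (11 / 10 * δ) (37 / 20 * δ)
    (fun s => lmono _ _ le_rfl (clδ s)) (fun s => lmono _ _ (clδ s) (cl2 s)) (by positivity)
    (by linarith) (by
      have : 8 * d * Real.log 2 / δ * (37 / 20 * δ - 11 / 10 * δ) = 6 * (d * Real.log 2) := by
        field_simp; ring
      rw [this]
      linarith)
  refine ⟨x, by linarith, by linarith, ?_⟩
  intro η hη
  rw [← hd_def] at hη ⊢
  have hη1 : |η| ≤ 1 / 16 := by
    have : |η| ≤ d * |η| := le_mul_of_one_le_left (abs_nonneg _) hd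
    norm_num at hη ⊢
    linarith
  have hηb := abs_le.1 hη1
  have hxpos : 0 < x := by linarith
  have hy1 : δ ≤ (1 + η) * x := by nlinarith
  have hy2 : (1 + η) * x ≤ 2 * δ := by nlinarith
  have h := hx ((1 + η) * x)
  have hfx : f x = Real.log (bohr N Γ x).card := by
    simp only [f]; rw [cle x (by linarith) (by linarith)]
  have hfy : f ((1 + η) * x) = Real.log (bohr N Γ ((1 + η) * x)).card := by
    simp only [f]; rw [cle _ hy1 hy2]
  rw [hfx, hfy, show (1 + η) * x - x = η * x by ring, abs_mul, abs_of_pos hxpos] at h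
  set u : ℝ := 2 ^ 4 * d * |η| with hu
  have hu0 : 0 ≤ u := by positivity
  have hu1 : u ≤ 1 := by rw [hu]; norm_num at hη ⊢; linarith
  have hK : 8 * d * Real.log 2 / δ * (|η| * x) ≤ u * Real.log 2 := by
    rw [div_mul_eq_mul_div, div_le_iff₀ hδ0, hu]
    have : 0 ≤ d * Real.log 2 * |η| := by positivity
    nlinarith
  have h := h.trans hK
  have px := cpos x (by linarith)
  have py := cpos _ hy1
  set A : ℝ := ((bohr N Γ x).card : ℝ)
  set B : ℝ := ((bohr N Γ ((1 + η) * x)).card : ℝ)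
  rw [abs_le] at h
  have hbern : (2 : ℝ) ^ u ≤ 1 + u := by
    have := rpow_one_add_le_one_add_mul_self (s := 1) (by norm_num) hu0 hu1
    norm_num at this
    exact this
  have hl1 : Real.log 2 ≤ 1 := by linarith [Real.log_two_lt_d9]
  constructor
  · rcases eq_or_lt_of_le hu1 with h1 | h1
    · rw [h1]; simp; exact py.le
    · have h3 : Real.log (1 - u) ≤ -u := by
        have := Real.log_le_sub_one_of_pos (show 0 < 1 - u by linarith)
        linarith
      rw [← Real.log_le_log_iff (mul_pos (by linarith) px) py,
        Real.log_mul (by linarith) px.ne']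
      nlinarith [h.1]
  · have h3 : u * Real.log 2 ≤ Real.log (1 + u) := by
      rw [← Real.log_rpow (by norm_num)]
      exact Real.log_le_log (by positivity) hbern
    rw [← Real.log_le_log_iff py (mul_pos (by linarith) px),
      Real.log_mul (by linarith) px.ne']
    linarith [h.2]
end

section
/- Let N be a positive integer, Γ ⊆ ℤ/Nℤ a finite set of frequencies, δ ∈ (0,1] such that B(Γ,δ) is regular, κ > 0 a parameter, and 0 < δ' ≤ δ. Then every frequency t ∈ ℤ/Nℤ with |β̂_{Γ,δ}(t)| ≥ κ satisfies |1 − e^{2πi t x/N}| ≤ 2⁵·|Γ|·κ⁻¹·δ'·δ⁻¹ for all x ∈ B(Γ,δ'). -/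
open Finset Complex
open scoped Pointwise BigOperators ComplexConjugate

lemma nint_sub_le (N : ℕ) [NeZero N] (a b : ZMod N) :
    nint (((a - b).val : ℝ) / N) ≤ nint ((a.val : ℝ) / N) + nint ((b.val : ℝ) / N) := by
  have hN : (N : ℝ) ≠ 0 := by exact_mod_cast NeZero.ne N
  obtain ⟨k, hk⟩ : ∃ k : ℤ, ((a - b).val : ℤ) - ((a.val : ℤ) - b.val) = N * k := by
    have : (N : ℤ) ∣ ((a - b).val : ℤ) - ((a.val : ℤ) - b.val) := by
      rw [← ZMod.intCast_zmod_eq_zero_iff_dvd]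
      push_cast
      simp
    exact this
  have hk' : ((a - b).val : ℝ) - ((a.val : ℝ) - b.val) = N * k := by exact_mod_cast hk
  have e : ((a - b).val : ℝ) / N = (a.val : ℝ) / N - (b.val : ℝ) / N + k := by
    field_simp
    linarith
  unfold nint
  refine (round_le _ (round ((a.val : ℝ) / N) - round ((b.val : ℝ) / N) + k)).trans ?_
  rw [e]
  push_cast
  have := abs_sub ((a.val : ℝ) / N - round ((a.val : ℝ) / N)) ((b.val : ℝ) / N - round ((b.val : ℝ) / N))
  refine le_trans (le_of_eq ?_) this
  congr 1
  ring

lemma chr_eq (N : ℕ) [NeZero N] (t x : ZMod N) : chr N t x = ZMod.stdAddChar (t * x) := by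
  rw [ZMod.stdAddChar_apply, ZMod.toCircle_apply, chr]

lemma norm_std (N : ℕ) [NeZero N] (x : ZMod N) : ‖(ZMod.stdAddChar x : ℂ)‖ = 1 := by
  rw [ZMod.stdAddChar_apply]; exact Circle.norm_coe _

lemma exp_eq (N : ℕ) [NeZero N] (t x : ZMod N) :
    Complex.exp (-(2 * Real.pi * Complex.I * (((t * x).val : ℕ) : ℂ) / N))
      = ZMod.stdAddChar (-(t * x)) := by
  rw [AddChar.map_neg_eq_inv, ZMod.stdAddChar_apply, ZMod.toCircle_apply, Complex.exp_neg]

lemma bound_sub {α : Type*} [DecidableEq α] (A B : Finset α) (h : A ⊆ B) (f : α → ℂ)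
    (hf : ∀ x, ‖f x‖ = 1) : ‖∑ x ∈ B, f x - ∑ x ∈ A, f x‖ ≤ (B.card : ℝ) - A.card := by
  rw [← Finset.sum_sdiff h, add_sub_cancel_right]
  refine (norm_sum_le _ _).trans ?_
  simp [hf, Finset.card_sdiff_of_subset h, Nat.cast_sub (Finset.card_le_card h)]

/-- **Nesting of the dual.** If `B(Γ,δ)` is regular, `κ > 0` and `0 < δ' ≤ δ`, then every
frequency `t` with `|β̂_{Γ,δ}(t)| ≥ κ` satisfies
`|1 - e^{2πi t x/N}| ≤ 2⁵ |Γ| κ⁻¹ δ' δ⁻¹` for all `x ∈ B(Γ,δ')`. -/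
theorem bohr_dual_nesting (N : ℕ) [NeZero N] (Γ : Finset (ZMod N)) (δ : ℝ)
    (hδ0 : 0 < δ) (hδ1 : δ ≤ 1) (hreg : BohrRegular N Γ δ)
    (κ : ℝ) (hκ : 0 < κ) (δ' : ℝ) (hδ'0 : 0 < δ') (hδ' : δ' ≤ δ) :
    ∀ t : ZMod N, κ ≤ ‖bohrFourier N Γ δ t‖ →
      ∀ x ∈ bohr N Γ δ',
        ‖1 - chr N t x‖ ≤ 2 ^ 5 * Γ.card * κ⁻¹ * δ' * δ⁻¹ := by
  classical
  intro t ht x hx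
  set B := bohr N Γ δ with hB
  set S : ℂ := ∑ y ∈ B, (ZMod.stdAddChar (-(t * y)) : ℂ) with hS
  have hF : bohrFourier N Γ δ t = (B.card : ℂ)⁻¹ * S := by
    simp only [bohrFourier, exp_eq, hS, hB]
  have hnF : ‖bohrFourier N Γ δ t‖ = (B.card : ℝ)⁻¹ * ‖S‖ := by
    rw [hF]; simp
  rw [hnF] at ht
  have hB0 : (0 : ℝ) < B.card := by
    rcases (Nat.cast_nonneg (α := ℝ) B.card).eq_or_lt with h | h
    · rw [← h] at ht; simp at ht; linarith
    · exact h
  have hκS : κ * B.card ≤ ‖S‖ := by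
    rw [inv_mul_eq_div, le_div_iff₀ hB0] at ht; exact ht
  have hSB : ‖S‖ ≤ B.card := by
    refine (norm_sum_le _ _).trans ?_
    simp [norm_std]
  rw [chr_eq]
  set c : ℂ := ZMod.stdAddChar (t * x) with hc
  have hc1 : ‖c‖ = 1 := norm_std _ _
  have hgoal : ‖1 - c‖ * κ ≤ 2 ^ 5 * (Γ.card * (δ' / δ)) →
      ‖1 - c‖ ≤ 2 ^ 5 * Γ.card * κ⁻¹ * δ' * δ⁻¹ := by
    intro h
    rw [← le_div_iff₀ hκ] at h
    refine h.trans (le_of_eq ?_)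
    field_simp
  apply hgoal
  have hη0 : 0 < δ' / δ := div_pos hδ'0 hδ0
  by_cases hη : (Γ.card : ℝ) * |δ' / δ| ≤ ((2 : ℝ) ^ 4)⁻¹
  · have hr := (hreg _ hη).2
    rw [abs_of_pos hη0] at hr
    set B' := bohr N Γ ((1 + δ' / δ) * δ) with hB'
    have e : (1 + δ' / δ) * δ = δ + δ' := by field_simp
    have s1 : B ⊆ B' := by
      intro y hy
      simp only [hB, hB', bohr, Finset.mem_filter, Finset.mem_univ, true_and] at hy ⊢
      intro u hu
      rw [e]; linarith [hy u hu]
    have s2 : B.image (fun y => y - x) ⊆ B' := by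
      intro z hz
      obtain ⟨y, hy, rfl⟩ := Finset.mem_image.1 hz
      simp only [hB, hB', bohr, Finset.mem_filter, Finset.mem_univ, true_and] at hy hx ⊢
      intro u hu
      rw [e, mul_sub]
      exact (nint_sub_le N _ _).trans (add_le_add (hy u hu) (hx u hu))
    have inj : Function.Injective (fun y : ZMod N => y - x) := sub_left_injective
    have b1 := bound_sub B B' s1 (fun y => (ZMod.stdAddChar (-(t * y)) : ℂ)) (fun _ => norm_std _ _)
    have b2 := bound_sub _ B' s2 (fun y => (ZMod.stdAddChar (-(t * y)) : ℂ)) (fun _ => norm_std _ _)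
    rw [Finset.card_image_of_injective _ inj, Finset.sum_image (fun a _ b _ h => inj h)] at b2
    have e2 : ∑ y ∈ B, (ZMod.stdAddChar (-(t * (y - x))) : ℂ) = c * S := by
      rw [hS, Finset.mul_sum]
      refine Finset.sum_congr rfl fun y _ => ?_
      rw [hc, ← AddChar.map_add_eq_mul]
      congr 1
      ring
    rw [e2] at b2
    rw [← hS] at b1
    have b3 := norm_sub_le (∑ y ∈ B', (ZMod.stdAddChar (-(t * y)) : ℂ) - c * S)
      (∑ y ∈ B', (ZMod.stdAddChar (-(t * y)) : ℂ) - S)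
    have e3 : (∑ y ∈ B', (ZMod.stdAddChar (-(t * y)) : ℂ) - c * S) -
      (∑ y ∈ B', (ZMod.stdAddChar (-(t * y)) : ℂ) - S) = (1 - c) * S := by ring
    rw [e3, norm_mul] at b3
    have b4 := mul_le_mul_of_nonneg_left hκS (norm_nonneg (1 - c))
    refine le_of_mul_le_mul_right ?_ hB0
    linarith
  · rw [abs_of_pos hη0] at hη
    have h1 : ‖1 - c‖ ≤ 2 := by
      have := norm_sub_le 1 c
      rw [hc1, norm_one] at this
      linarith
    have h2 : κ ≤ 1 := by
      by_contra h
      nlinarith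
    have h3 : ‖1 - c‖ * κ ≤ 2 * 1 := mul_le_mul h1 h2 hκ.le (by norm_num)
    norm_num at hη
    linarith
end

section
/- Let N be a positive integer, Γ ⊆ ℤ/Nℤ a finite set of frequencies and δ ∈ (0,1] with B(Γ,δ) regular. Let A ⊆ B(Γ,δ) have relative density α := |A|/|B(Γ,δ)| > 0, and let ρ ∈ (0,1]. Suppose δ' satisfies 2·(ρα/(2(1+|Γ|)))^{2⁶}·δ ≤ δ' ≤ 4·(ρα/(2(1+|Γ|)))^{2⁶}·δ, and that there is a finite set Λ ⊆ ℤ/Nℤ which is S-dissociated for S := {t : |β̂_{Γ,δ'}(t)| ≥ 1/3}, with |Λ| ≥ 2⁷·ρ⁻¹·(1 + log α⁻¹), such that every λ ∈ Λ satisfies |Σ_{a ∈ A} e^{−2πi λ a/N}| ≥ ρ·α·|B(Γ,δ)|. Then there exist a finite set Γ' ⊆ ℤ/Nℤ and δ'' > 0 such that B(Γ',δ'') is regular, δ'' ≥ (ρα/(2(1+|Γ|)))^{2⁶}·δ, |Γ'| ≤ |Γ| + ρ·|Λ|/(2⁴(1 + log α⁻¹)), and there is x ∈ ℤ/Nℤ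 with |A ∩ (x + B(Γ',δ''))| ≥ α·(1 + ρ²·|Λ|/(2¹²(1 + log α⁻¹)))·|B(Γ',δ'')|. -/
open Finset Complex
open scoped Pointwise BigOperators ComplexConjugate

lemma di_two_sided (g : ℝ → ℝ) (hg : Monotone g)
    (hrc : ∀ s, ∃ r > 0, ∀ s', s ≤ s' → s' ≤ s + r → g s' = g s)
    (M a b a' b' : ℝ) (hM : 0 < M) (haa : a ≤ a') (hab : a' ≤ b') (hbb : b' ≤ b)
    (hlt : 2 * (g b - g a) < M * (b' - a')) :
    ∃ s, a' ≤ s ∧ s ≤ b' ∧ (∀ s', s ≤ s' → s' ≤ b → g s' - g s ≤ M * (s' - s)) ∧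
      (∀ s', a ≤ s' → s' ≤ s → g s - g s' ≤ M * (s - s')) := by
  by_contra hcon
  push Not at hcon
  obtain ⟨gR, hR1, hR2⟩ : ∃ gR : ℝ → ℝ, (∀ s s', s ≤ s' → s' ≤ b → g s' - M * (s' - s) ≤ gR s) ∧
      (∀ s C, s ≤ b → (∀ s', s ≤ s' → s' ≤ b → g s' - M * (s' - s) ≤ C) → gR s ≤ C) := by
    refine ⟨fun s => sSup ((fun s' => g s' - M * (s' - s)) '' Set.Icc s b), ?_, ?_⟩
    · intro s s' h1 h2
      apply le_csSup
      · refine ⟨g b, ?_⟩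
        rintro _ ⟨y, ⟨hy1, hy2⟩, rfl⟩
        have := hg hy2
        have : 0 ≤ M * (y - s) := mul_nonneg hM.le (by linarith)
        simp only; linarith
      · exact ⟨s', ⟨h1, h2⟩, rfl⟩
    · intro s C hs hC
      apply csSup_le
      · exact ⟨_, s, ⟨le_rfl, hs⟩, rfl⟩
      · rintro _ ⟨y, ⟨hy1, hy2⟩, rfl⟩
        exact hC y hy1 hy2
  obtain ⟨gL, hL1, hL2⟩ : ∃ gL : ℝ → ℝ, (∀ s s', a ≤ s' → s' ≤ s → gL s ≤ g s' + M * (s - s')) ∧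
      (∀ s C, a ≤ s → (∀ s', a ≤ s' → s' ≤ s → C ≤ g s' + M * (s - s')) → C ≤ gL s) := by
    refine ⟨fun s => sInf ((fun s' => g s' + M * (s - s')) '' Set.Icc a s), ?_, ?_⟩
    · intro s s' h1 h2
      apply csInf_le
      · refine ⟨g a, ?_⟩
        rintro _ ⟨y, ⟨hy1, hy2⟩, rfl⟩
        have := hg hy1
        have : 0 ≤ M * (s - y) := mul_nonneg hM.le (by linarith)
        simp only; linarith
      · exact ⟨s', ⟨h1, h2⟩, rfl⟩
    · intro s C hs hC
      apply le_csInf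
      · exact ⟨_, s, ⟨hs, le_rfl⟩, rfl⟩
      · rintro _ ⟨y, ⟨hy1, hy2⟩, rfl⟩
        exact hC y hy1 hy2
  have hRm : ∀ s1 s2, s1 ≤ s2 → s2 ≤ b → gR s1 ≤ gR s2 := by
    intro s1 s2 h12 h2
    apply hR2 _ _ (h12.trans h2)
    intro s' h1 h3
    rcases le_total s2 s' with h | h
    · have := hR1 s2 s' h h3
      nlinarith
    · have := hR1 s2 s2 le_rfl h2
      have := hg h
      nlinarith
  have hLm : ∀ s1 s2, a ≤ s1 → s1 ≤ s2 → gL s1 ≤ gL s2 := by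
    intro s1 s2 h1 h12
    apply hL2 _ _ (h1.trans h12)
    intro s' h3 h4
    rcases le_total s' s1 with h | h
    · have := hL1 s1 s' h3 h
      nlinarith
    · have := hL1 s1 s1 h1 le_rfl
      have := hg h
      nlinarith
  set T : Set ℝ := {s | a' ≤ s ∧ s ≤ b' ∧ gR a' + gL a' + M * (s - a') ≤ gR s + gL s} with hT
  have haT : a' ∈ T := ⟨le_rfl, hab, by simp⟩
  have hTb : BddAbove T := ⟨b', fun s hs => hs.2.1⟩
  set c := sSup T with hc
  have hc1 : a' ≤ c := le_csSup hTb haT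
  have hc2 : c ≤ b' := csSup_le ⟨_, haT⟩ (fun s hs => hs.2.1)
  have hcT : c ∈ T := by
    refine ⟨hc1, hc2, ?_⟩
    have : c ≤ a' + (gR c + gL c - (gR a' + gL a')) / M := by
      apply csSup_le ⟨_, haT⟩
      intro s hs
      have hsc : s ≤ c := le_csSup hTb hs
      have h1 := hRm s c hsc (hc2.trans hbb)
      have h2 := hLm s c (haa.trans hs.1) hsc
      have h3 := hs.2.2
      have : (s - a') ≤ (gR c + gL c - (gR a' + gL a')) / M := by
        rw [le_div_iff₀ hM]; nlinarith
      linarith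
    have h4 : c - a' ≤ (gR c + gL c - (gR a' + gL a')) / M := by linarith
    rw [le_div_iff₀ hM] at h4
    nlinarith
  have hcb : c = b' := by
    by_contra hne
    have hlt' : c < b' := lt_of_le_of_ne hc2 hne
    have key : ∃ t, 0 < t ∧ t ≤ b' - c ∧ M * t ≤ (gR (c + t) + gL (c + t)) - (gR c + gL c) := by
      by_cases hbad : ∀ s', c ≤ s' → s' ≤ b → g s' - g c ≤ M * (s' - c)
      · obtain ⟨s', h1, h2, h3⟩ := hcon c hc1 hc2 hbad
        have h4 : gL c < g c := by
          have := hL1 c s' h1 h2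
          linarith
        set t := min (b' - c) ((g c - gL c) / M) with ht
        have ht0 : 0 < t := lt_min (by linarith) (div_pos (by linarith) hM)
        have ht1 : t ≤ b' - c := min_le_left _ _
        have ht2 : M * t ≤ g c - gL c := by
          have : t ≤ (g c - gL c) / M := min_le_right _ _
          rw [le_div_iff₀ hM] at this
          linarith
        refine ⟨t, ht0, ht1, ?_⟩
        have h5 := hRm c (c + t) (by linarith) (by linarith)
        have h6 : gL c + M * t ≤ gL (c + t) := by
          apply hL2 _ _ (by linarith)
          intro y hy1 hy2
          rcases le_total y c with h | h
          · have := hL1 c y hy1 h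
            nlinarith
          · have := hg h
            nlinarith
        linarith
      · push Not at hbad
        obtain ⟨s', h1, h2, h3⟩ := hbad
        have h4 : g c < gR c := by
          have := hR1 c s' h1 h2
          linarith
        obtain ⟨r, hr, hrs⟩ := hrc c
        set t := min (b' - c) r with ht
        have ht0 : 0 < t := lt_min (by linarith) hr
        have ht1 : t ≤ b' - c := min_le_left _ _
        have ht2 : t ≤ r := min_le_right _ _
        refine ⟨t, ht0, ht1, ?_⟩
        have h5 := hLm c (c + t) (by linarith) (by linarith)
        have h6 : gR c ≤ max (g c) (gR (c + t) - M * t) := by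
          apply hR2 _ _ (by linarith)
          intro y hy1 hy2
          rcases le_total y (c + t) with h | h
          · apply le_max_of_le_left
            have := hrs y hy1 (by linarith)
            nlinarith
          · apply le_max_of_le_right
            have := hR1 (c + t) y h hy2
            nlinarith
        rcases le_max_iff.1 h6 with h | h <;> linarith
    obtain ⟨t, ht0, ht1, ht2⟩ := key
    have : c + t ∈ T := by
      refine ⟨by linarith, by linarith, ?_⟩
      have := hcT.2.2
      nlinarith
    have := le_csSup hTb this
    linarith
  have h1 := hcT.2.2
  rw [hcb] at h1
  have h2 : gR b' ≤ g b := by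
    apply hR2 _ _ hbb
    intro s' h3 h4
    have := hg h4
    nlinarith
  have h3 : gL b' ≤ g b := by
    have := hL1 b' b' (by linarith) le_rfl
    have := hg hbb
    linarith
  have h4 : g a ≤ gR a' := by
    have := hR1 a' a' le_rfl (by linarith)
    have := hg haa
    linarith
  have h5 : g a ≤ gL a' := by
    apply hL2 _ _ haa
    intro s' h3 h4
    have := hg h3
    nlinarith
  linarith
lemma di_nint (N : ℕ) [NeZero N] (z : ZMod N) :
    nint ((z.val : ℝ) / N) = ‖ZMod.toAddCircle z‖ := by
  rw [ZMod.toAddCircle_apply, UnitAddCircle.norm_eq, nint]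

lemma di_mem_bohr (N : ℕ) [NeZero N] (Γ : Finset (ZMod N)) (δ : ℝ) (x : ZMod N) :
    x ∈ bohr N Γ δ ↔ ∀ t ∈ Γ, ‖ZMod.toAddCircle (t * x)‖ ≤ δ := by
  simp only [bohr, di_nint, Finset.mem_filter, Finset.mem_univ, true_and]

lemma di_bohr_mono (N : ℕ) [NeZero N] (Γ : Finset (ZMod N)) {δ δ' : ℝ} (h : δ ≤ δ') :
    bohr N Γ δ ⊆ bohr N Γ δ' := by
  intro x hx
  rw [di_mem_bohr] at *
  exact fun t ht => (hx t ht).trans h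

lemma di_bohr_anti (N : ℕ) [NeZero N] {Γ Γ' : Finset (ZMod N)} (h : Γ ⊆ Γ') (δ : ℝ) :
    bohr N Γ' δ ⊆ bohr N Γ δ := by
  intro x hx
  rw [di_mem_bohr] at *
  exact fun t ht => hx t (h ht)

lemma di_bohr_add (N : ℕ) [NeZero N] (Γ : Finset (ZMod N)) {δ δ' : ℝ} {x y : ZMod N}
    (hx : x ∈ bohr N Γ δ) (hy : y ∈ bohr N Γ δ') : x + y ∈ bohr N Γ (δ + δ') := by
  rw [di_mem_bohr] at *
  intro t ht
  rw [mul_add, map_add]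
  exact (norm_add_le _ _).trans (add_le_add (hx t ht) (hy t ht))

lemma di_bohr_neg (N : ℕ) [NeZero N] (Γ : Finset (ZMod N)) {δ : ℝ} {x : ZMod N}
    (hx : x ∈ bohr N Γ δ) : -x ∈ bohr N Γ δ := by
  rw [di_mem_bohr] at *
  intro t ht
  rw [mul_neg, map_neg, norm_neg]
  exact hx t ht

lemma di_bohr_zero (N : ℕ) [NeZero N] (Γ : Finset (ZMod N)) {δ : ℝ} (h : 0 ≤ δ) :
    (0 : ZMod N) ∈ bohr N Γ δ := by
  rw [di_mem_bohr]
  intro t _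
  simpa using h

lemma di_bohr_card_pos (N : ℕ) [NeZero N] (Γ : Finset (ZMod N)) {δ : ℝ} (h : 0 ≤ δ) :
    0 < ((bohr N Γ δ).card : ℝ) := by
  exact_mod_cast Finset.card_pos.2 ⟨0, di_bohr_zero N Γ h⟩

lemma di_exp_neg (N : ℕ) [NeZero N] (z : ZMod N) :
    Complex.exp (-(2 * Real.pi * Complex.I * ((z.val : ℕ) : ℂ) / N)) = ZMod.stdAddChar (-z) := by
  rw [AddChar.map_neg_eq_inv, ZMod.stdAddChar_apply, ZMod.toCircle_apply, ← Complex.exp_neg]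

lemma di_norm_e (N : ℕ) [NeZero N] (z : ZMod N) : ‖(ZMod.stdAddChar z : ℂ)‖ = 1 := by
  rw [ZMod.stdAddChar_apply]; exact Circle.norm_coe _

lemma di_norm_e_sub (N : ℕ) [NeZero N] (z : ZMod N) :
    ‖(ZMod.stdAddChar z : ℂ) - 1‖ ≤ 2 * Real.pi * ‖ZMod.toAddCircle z‖ := by
  rw [← di_nint, ZMod.stdAddChar_apply, ZMod.toCircle_apply, nint]
  set r : ℝ := (z.val : ℝ) / N with hr
  have h1 : Complex.exp (2 * Real.pi * Complex.I * (z.val : ℂ) / N) =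
      Complex.exp (Complex.I * ((2 * Real.pi * (r - round r) : ℝ) : ℂ)) := by
    rw [Complex.exp_eq_exp_iff_exists_int]
    refine ⟨round r, ?_⟩
    rw [hr]; push_cast; ring
  rw [h1]
  refine Real.norm_exp_I_mul_ofReal_sub_one_le.trans ?_
  rw [Real.norm_eq_abs, abs_mul, abs_of_pos Real.two_pi_pos]

lemma di_doubling (N : ℕ) [NeZero N] (Γ : Finset (ZMod N)) {δ : ℝ} (hδ : 0 < δ) :
    (bohr N Γ (2 * δ)).card ≤ (bohr N Γ δ).card * 5 ^ Γ.card := by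
  classical
  set v : ZMod N → ℝ := fun z => (z.val : ℝ) / N - round ((z.val : ℝ) / N) with hv
  have hvn : ∀ z, |v z| = ‖ZMod.toAddCircle z‖ := by
    intro z; rw [← di_nint, nint]
  have hvc : ∀ z : ZMod N, ZMod.toAddCircle z = ((v z : ℝ) : UnitAddCircle) := by
    intro z
    rw [ZMod.toAddCircle_apply, hv]
    simp only [AddCircle.coe_sub]
    rw [eq_comm, sub_eq_self, AddCircle.coe_eq_zero_iff]
    exact ⟨round ((z.val : ℝ) / N), by simp⟩
  set f : ZMod N → (ZMod N → ℤ) := fun x t => if t ∈ Γ then ⌊v (t * x) / δ⌋ else 0 with hf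
  set T : Finset (ZMod N → ℤ) := Fintype.piFinset
    (fun t => if t ∈ Γ then Finset.Icc (-2 : ℤ) 2 else {0}) with hT
  have hTc : T.card = 5 ^ Γ.card := by
    rw [hT, Fintype.card_piFinset]
    have : ∀ t : ZMod N, (if t ∈ Γ then Finset.Icc (-2 : ℤ) 2 else {0}).card
        = if t ∈ Γ then 5 else 1 := by
      intro t; split_ifs <;> rfl
    simp only [this]
    rw [Finset.prod_ite]; simp
  rw [← hTc]
  apply Finset.card_le_mul_card_image_of_maps_to (f := f)
  · intro x hx
    rw [di_mem_bohr] at hx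
    rw [hT, Fintype.mem_piFinset]
    intro t
    simp only [hf]
    by_cases ht : t ∈ Γ
    · simp only [ht, if_true, Finset.mem_Icc]
      have h1 := hx t ht
      rw [← hvn, abs_le] at h1
      constructor
      · rw [Int.le_floor, le_div_iff₀ hδ]; push_cast; linarith
      · have : v (t * x) / δ < (3 : ℤ) := by
          rw [div_lt_iff₀ hδ]; push_cast; linarith
        have := Int.floor_lt.2 this
        omega
    · simp [ht]
  · intro m _
    rcases (Finset.filter (fun x => f x = m) (bohr N Γ (2 * δ))).eq_empty_or_nonempty with h | ⟨x0, hx0⟩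
    · rw [h]; simp
    · apply Finset.card_le_card_of_injOn (fun x => x - x0)
      · intro x hx
        simp only [Finset.coe_filter, Set.mem_ofPred_eq] at hx
        rw [Finset.mem_filter] at hx0
        have hfe := hx.2.trans hx0.2.symm
        simp only [Finset.mem_coe]
        rw [di_mem_bohr]
        intro t ht
        have h2 := congrFun hfe t
        simp only [hf, ht, if_true] at h2
        have h3 := Int.abs_sub_lt_one_of_floor_eq_floor h2
        rw [← sub_div, abs_div, abs_of_pos hδ, div_lt_one hδ] at h3
        rw [mul_sub, map_sub, hvc, hvc, ← AddCircle.coe_sub]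
        refine le_trans ?_ h3.le
        rw [UnitAddCircle.norm_eq]
        simpa using round_le (v (t * x) - v (t * x0)) 0
      · intro x _ y _ h
        simpa using h

lemma di_right_step (N : ℕ) [NeZero N] (Γ : Finset (ZMod N)) (δ : ℝ) :
    ∃ r > 0, ∀ δ', δ ≤ δ' → δ' ≤ δ + r → bohr N Γ δ' = bohr N Γ δ := by
  have h : ∀ x t : ZMod N, ∃ r > 0, ∀ δ', δ' ≤ δ + r → ‖ZMod.toAddCircle (t * x)‖ ≤ δ' →
      ‖ZMod.toAddCircle (t * x)‖ ≤ δ := by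
    intro x t
    by_cases hx : ‖ZMod.toAddCircle (t * x)‖ ≤ δ
    · exact ⟨1, one_pos, fun _ _ _ => hx⟩
    · push Not at hx
      exact ⟨(‖ZMod.toAddCircle (t * x)‖ - δ) / 2, by linarith, fun δ' h1 h2 => by linarith⟩
  choose r hr0 hr using h
  have hne : (Finset.univ : Finset (ZMod N × ZMod N)).Nonempty := Finset.univ_nonempty
  obtain ⟨p, _, hp⟩ := Finset.exists_min_image Finset.univ (fun p : ZMod N × ZMod N => r p.1 p.2) hne
  refine ⟨r p.1 p.2, hr0 _ _, fun δ' h1 h2 => ?_⟩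
  apply Finset.Subset.antisymm _ (di_bohr_mono N Γ h1)
  intro x hx
  rw [di_mem_bohr] at *
  intro t ht
  exact hr x t δ' (h2.trans (by have := hp (x, t) (Finset.mem_univ _); simp only at this; linarith)) (hx t ht)
lemma di_exists_regular (N : ℕ) [NeZero N] (Γ : Finset (ZMod N)) {δ : ℝ} (hδ : 0 < δ) :
    ∃ r, 1 ≤ r ∧ r ≤ 2 ∧ BohrRegular N Γ (r * δ) := by
  rcases Γ.eq_empty_or_nonempty with h | hne
  · subst h
    refine ⟨1, le_rfl, by norm_num, ?_⟩
    intro η _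
    have : ∀ r : ℝ, bohr N ∅ r = Finset.univ := by
      intro r; ext x; simp [di_mem_bohr]
    simp [this]
  have hd : (1 : ℝ) ≤ (Γ.card : ℝ) := by exact_mod_cast Finset.card_pos.2 hne
  set d : ℝ := (Γ.card : ℝ) with hdd
  set g : ℝ → ℝ := fun r => Real.log ((bohr N Γ (r * δ)).card : ℝ) with hgdef
  have hmono : Monotone g := by
    intro r r' hrr
    have h1 : (bohr N Γ (r * δ)).card ≤ (bohr N Γ (r' * δ)).card :=
      Finset.card_le_card (di_bohr_mono N Γ (by nlinarith))
    rcases Nat.eq_zero_or_pos (bohr N Γ (r * δ)).card with h0 | h0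
    · simp only [hgdef, h0, Nat.cast_zero, Real.log_zero]
      exact Real.log_natCast_nonneg _
    · apply Real.log_le_log (by exact_mod_cast h0) (by exact_mod_cast h1)
  have hrc : ∀ s, ∃ r > 0, ∀ s', s ≤ s' → s' ≤ s + r → g s' = g s := by
    intro s
    obtain ⟨r, hr, h⟩ := di_right_step N Γ (s * δ)
    refine ⟨r / δ, div_pos hr hδ, fun s' h1 h2 => ?_⟩
    simp only [hgdef]
    rw [h (s' * δ) (by nlinarith)]
    have : (s + r / δ) * δ = s * δ + r := by field_simp
    rw [← this]; nlinarith
  have hg12 : g 2 - g 1 ≤ d * (3 * Real.log 2) := by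
    have h1 := di_doubling N Γ hδ
    have h2 : ((bohr N Γ (2 * δ)).card : ℝ) ≤ (bohr N Γ δ).card * 8 ^ Γ.card := by
      have h3 : ((bohr N Γ (2 * δ)).card : ℝ) ≤ (bohr N Γ δ).card * 5 ^ Γ.card := by exact_mod_cast h1
      refine h3.trans ?_
      gcongr; norm_num
    have hp := di_bohr_card_pos N Γ hδ.le
    have hp2 := di_bohr_card_pos N Γ (δ := 2 * δ) (by linarith)
    have h3 := Real.log_le_log hp2 h2
    rw [Real.log_mul hp.ne' (by positivity), Real.log_pow] at h3
    have h8 : Real.log 8 = 3 * Real.log 2 := by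
      rw [show (8 : ℝ) = 2 ^ 3 by norm_num, Real.log_pow]; norm_num
    rw [h8] at h3
    simp only [hgdef, one_mul]
    linarith
  have hl2 := Real.log_two_lt_d9
  have hl2' := Real.log_two_gt_d9
  obtain ⟨s, hs1, hs2, hR, hL⟩ := di_two_sided g hmono hrc (11 / 2 * d) 1 2 (16 / 15) (32 / 17)
    (by positivity) (by norm_num) (by norm_num) (by norm_num) (by nlinarith)
  refine ⟨s, by linarith, by linarith, ?_⟩
  intro η hη
  rw [← hdd] at *
  have hpos : ∀ r : ℝ, 0 ≤ r → 0 < ((bohr N Γ (r * δ)).card : ℝ) :=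
    fun r hr => di_bohr_card_pos N Γ (mul_nonneg hr hδ.le)
  have hcs := hpos s (by linarith)
  have hre : (1 + η) * (s * δ) = (s * (1 + η)) * δ := by ring
  rw [hre]
  have hη1 : |η| ≤ 1 / 16 := by
    have := abs_nonneg η
    norm_num at hη
    nlinarith
  have hx0 : 0 ≤ d * |η| := by positivity
  norm_num at hη
  rcases le_total 0 η with h0 | h0
  · rw [abs_of_nonneg h0] at *
    have hc' := hpos (s * (1 + η)) (by nlinarith)
    constructor
    · have : ((bohr N Γ (s * δ)).card : ℝ) ≤ (bohr N Γ (s * (1 + η) * δ)).card := by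
        exact_mod_cast Finset.card_le_card (di_bohr_mono N Γ
          (mul_le_mul_of_nonneg_right (by nlinarith) hδ.le))
      nlinarith
    · have h1 := hR (s * (1 + η)) (by nlinarith) (by nlinarith)
      have h2 : 11 / 2 * d * (s * (1 + η) - s) ≤ 11 * (d * η) := by nlinarith
      have h3 : Real.log ((bohr N Γ (s * (1 + η) * δ)).card : ℝ) ≤
        Real.log ((bohr N Γ (s * δ)).card : ℝ) + 11 * (d * η) := by
          simp only [hgdef] at h1; linarith
      have h4 := Real.exp_le_exp.2 h3
      rw [Real.exp_add, Real.exp_log hc', Real.exp_log hcs] at h4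
      have h5 : Real.exp (11 * (d * η)) ≤ 1 + 16 * d * η := by
        have h6 : Real.exp (11 * (d * η)) ≤ Real.exp (Real.log 2 * (16 * (d * η))) := by
          apply Real.exp_le_exp.2; nlinarith
        have h7 : Real.exp (Real.log 2 * (16 * (d * η))) = (1 + 1 : ℝ) ^ (16 * (d * η)) := by
          rw [Real.rpow_def_of_pos (by norm_num)]; norm_num
        have h8 := _root_.rpow_one_add_le_one_add_mul_self (s := 1) (by norm_num)
          (p := 16 * (d * η)) (by linarith) (by linarith)
        rw [h7] at h6
        linarith
      norm_num
      nlinarith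
  · rw [abs_of_nonpos h0] at *
    have hc' := hpos (s * (1 + η)) (by nlinarith)
    constructor
    · have h1 := hL (s * (1 + η)) (by nlinarith) (by nlinarith)
      have h2 : 11 / 2 * d * (s - s * (1 + η)) ≤ 11 * (d * -η) := by nlinarith
      have h3 : Real.log ((bohr N Γ (s * δ)).card : ℝ) + -(11 * (d * -η)) ≤
        Real.log ((bohr N Γ (s * (1 + η) * δ)).card : ℝ) := by
          simp only [hgdef] at h1; linarith
      have h4 := Real.exp_le_exp.2 h3
      rw [Real.exp_add, Real.exp_log hc', Real.exp_log hcs] at h4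
      have h5 := Real.add_one_le_exp (-(11 * (d * -η)))
      norm_num
      nlinarith
    · have : ((bohr N Γ (s * (1 + η) * δ)).card : ℝ) ≤ (bohr N Γ (s * δ)).card := by
        exact_mod_cast Finset.card_le_card (di_bohr_mono N Γ
          (mul_le_mul_of_nonneg_right (by nlinarith) hδ.le))
      nlinarith
lemma di_map_sum (N : ℕ) [NeZero N] {ι : Type*} (s : Finset ι) (f : ι → ZMod N) :
    (ZMod.stdAddChar (∑ i ∈ s, f i) : ℂ) = ∏ i ∈ s, (ZMod.stdAddChar (f i) : ℂ) := by
  classical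
  induction s using Finset.induction_on with
  | empty => simp
  | insert a s ha ih => rw [Finset.sum_insert ha, Finset.prod_insert ha, AddChar.map_add_eq_mul, ih]

lemma di_smooth_step (N : ℕ) [NeZero N] (Γ : Finset (ZMod N)) {δ' : ℝ} (hδ' : 0 < δ') (r : ℝ)
    (h : ZMod N → ℝ) (h0 : ∀ x, 0 ≤ h x) :
    ∑ x ∈ bohr N Γ r, h x ≤
      ∑ z ∈ bohr N Γ (r + δ'), ((bohr N Γ δ').card : ℝ)⁻¹ * ∑ y ∈ bohr N Γ δ', h (z - y) := by
  have hc := di_bohr_card_pos N Γ hδ'.le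
  rw [← Finset.mul_sum, Finset.sum_comm, ← div_eq_inv_mul, le_div_iff₀ hc, mul_comm,
    ← nsmul_eq_mul, ← Finset.sum_const]
  apply Finset.sum_le_sum
  intro y hy
  calc ∑ x ∈ bohr N Γ r, h x = ∑ z ∈ (bohr N Γ r).image (fun x => x + y), h (z - y) := by
        rw [Finset.sum_image (by intro a _ b _ hab; simpa using hab)]
        simp
    _ ≤ _ := by
        apply Finset.sum_le_sum_of_subset_of_nonneg
        · intro z hz
          obtain ⟨x, hx, rfl⟩ := Finset.mem_image.1 hz
          exact di_bohr_add N Γ hx hy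
        · intro i _ _; exact h0 _

lemma di_bohrFourier (N : ℕ) [NeZero N] (Γ : Finset (ZMod N)) (δ : ℝ) (t : ZMod N) :
    bohrFourier N Γ δ t = ((bohr N Γ δ).card : ℂ)⁻¹ *
      ∑ x ∈ bohr N Γ δ, ZMod.stdAddChar (-(t * x)) := by
  simp only [bohrFourier, di_exp_neg]

lemma di_smooth (N : ℕ) [NeZero N] (Γ : Finset (ZMod N)) {δ' : ℝ} (hδ' : 0 < δ') (r : ℝ)
    {ι : Type*} (I : Finset ι) (W : ι → ℂ) (θ : ι → ZMod N)
    (h0 : ∀ x, 0 ≤ (∑ m ∈ I, W m * ZMod.stdAddChar (θ m * x)).re) (l : ℕ) :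
    (∀ x, 0 ≤ (∑ m ∈ I, W m * bohrFourier N Γ δ' (θ m) ^ l * ZMod.stdAddChar (θ m * x)).re) ∧
    ∑ x ∈ bohr N Γ r, (∑ m ∈ I, W m * ZMod.stdAddChar (θ m * x)).re ≤
      ∑ x ∈ bohr N Γ (r + l * δ'),
        (∑ m ∈ I, W m * bohrFourier N Γ δ' (θ m) ^ l * ZMod.stdAddChar (θ m * x)).re := by
  induction l with
  | zero => simpa using h0
  | succ l ih =>
    obtain ⟨ih1, ih2⟩ := ih
    have key : ∀ z, (∑ m ∈ I, W m * bohrFourier N Γ δ' (θ m) ^ (l + 1) *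
        ZMod.stdAddChar (θ m * z)).re = ((bohr N Γ δ').card : ℝ)⁻¹ * ∑ y ∈ bohr N Γ δ',
        (∑ m ∈ I, W m * bohrFourier N Γ δ' (θ m) ^ l * ZMod.stdAddChar (θ m * (z - y))).re := by
      intro z
      rw [← Complex.re_sum, ← Complex.re_ofReal_mul]
      congr 1
      rw [Finset.sum_comm, Finset.mul_sum]
      apply Finset.sum_congr rfl
      intro m _
      rw [pow_succ]
      nth_rewrite 2 [di_bohrFourier]
      rw [← Finset.mul_sum]
      have : ∑ y ∈ bohr N Γ δ', (ZMod.stdAddChar (θ m * (z - y)) : ℂ) =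
          (∑ y ∈ bohr N Γ δ', ZMod.stdAddChar (-(θ m * y))) * ZMod.stdAddChar (θ m * z) := by
        rw [Finset.sum_mul]
        apply Finset.sum_congr rfl
        intro y _
        rw [← AddChar.map_add_eq_mul]
        congr 1; ring
      rw [this]
      push_cast
      ring
    constructor
    · intro x
      rw [key]
      apply mul_nonneg (by positivity)
      exact Finset.sum_nonneg fun y _ => ih1 _
    · refine ih2.trans ((di_smooth_step N Γ hδ' _ _ ih1).trans ?_)
      have : r + ((l + 1 : ℕ) : ℝ) * δ' = r + l * δ' + δ' := by push_cast; ring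
      rw [this]
      simp only [key]
      exact le_rfl

lemma di_riesz (N : ℕ) [NeZero N] (Γ : Finset (ZMod N)) {δ' : ℝ} (hδ' : 0 < δ') (r : ℝ)
    (Λ : Finset (ZMod N))
    (hdiss : SDissociated {t : ZMod N | 1 / 3 ≤ ‖bohrFourier N Γ δ' t‖} Λ)
    (c : ZMod N → ℂ) (hc : ∀ t, ‖c t‖ = 1) (τ : ℝ) (hτ0 : 0 ≤ τ) (hτ1 : τ ≤ 1) (l : ℕ) :
    ∑ x ∈ bohr N Γ r, ∏ t ∈ Λ, (1 + τ * (c t * ZMod.stdAddChar (-(t * x))).re) ≤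
      (1 + (1 / 3) ^ l * (1 + τ) ^ Λ.card) * (bohr N Γ (r + l * δ')).card := by
  classical
  set J : ZMod N → Finset ℤ := fun t => if t ∈ Λ then {-1, 0, 1} else {0} with hJ
  set w : ZMod N → ℤ → ℂ := fun t j => if j = 0 then 1 else if j = 1 then τ / 2 * conj (c t)
    else τ / 2 * c t with hw
  set I := Fintype.piFinset J with hI
  set W : (ZMod N → ℤ) → ℂ := fun m => ∏ t, w t (m t) with hW
  set θ : (ZMod N → ℤ) → ZMod N := fun m => ∑ t, m t • t with hθ
  have hexp : ∀ x, ((∏ t ∈ Λ, (1 + τ * (c t * ZMod.stdAddChar (-(t * x))).re) : ℝ) : ℂ) =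
      ∑ m ∈ I, W m * ZMod.stdAddChar (θ m * x) := by
    intro x
    have h1 : ∀ t, ∑ j ∈ J t, w t j * ZMod.stdAddChar ((j • t) * x) =
        if t ∈ Λ then ((1 + τ * (c t * ZMod.stdAddChar (-(t * x))).re : ℝ) : ℂ) else 1 := by
      intro t
      by_cases ht : t ∈ Λ
      · simp only [hJ, ht, if_true]
        rw [Finset.sum_insert (by decide), Finset.sum_insert (by decide), Finset.sum_singleton]
        simp only [hw]
        have h2 : (ZMod.stdAddChar (t * x) : ℂ) = conj (ZMod.stdAddChar (-(t * x))) := by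
          rw [AddChar.map_neg_eq_conj, Complex.conj_conj]
        have h3 := Complex.re_eq_add_conj (c t * ZMod.stdAddChar (-(t * x)))
        rw [map_mul] at h3
        generalize (c t * ZMod.stdAddChar (-(t * x))).re = R at h3 ⊢
        rw [← h2] at h3
        norm_num
        rw [h3]
        ring
      · simp [hJ, ht, hw]
    have h2 : ((∏ t ∈ Λ, (1 + τ * (c t * ZMod.stdAddChar (-(t * x))).re) : ℝ) : ℂ) =
        ∏ t, ∑ j ∈ J t, w t j * ZMod.stdAddChar ((j • t) * x) := by
      simp only [h1]
      rw [Finset.prod_ite_mem, Finset.univ_inter, Complex.ofReal_prod]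
    rw [h2, Finset.prod_univ_sum]
    apply Finset.sum_congr rfl
    intro m _
    rw [Finset.prod_mul_distrib, hW, hθ]
    simp only
    rw [Finset.sum_mul, di_map_sum]
  have hre : ∀ x, ∏ t ∈ Λ, (1 + τ * (c t * ZMod.stdAddChar (-(t * x))).re) =
      (∑ m ∈ I, W m * ZMod.stdAddChar (θ m * x)).re := by
    intro x
    rw [← hexp, Complex.ofReal_re]
  have hnn : ∀ x, 0 ≤ (∑ m ∈ I, W m * ZMod.stdAddChar (θ m * x)).re := by
    intro x
    rw [← hre]
    apply Finset.prod_nonneg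
    intro t _
    have h1 := Complex.abs_re_le_norm (c t * ZMod.stdAddChar (-(t * x)))
    rw [norm_mul, hc, di_norm_e, one_mul, abs_le] at h1
    nlinarith
  obtain ⟨_, h2⟩ := di_smooth N Γ hδ' r I W θ hnn l
  simp only [hre]
  refine h2.trans ?_
  refine (Finset.sum_le_card_nsmul _ _ (1 + (1 / 3) ^ l * (1 + τ) ^ Λ.card) ?_).trans
    (by rw [nsmul_eq_mul]; exact (mul_comm _ _).le)
  intro x _
  refine (Complex.re_le_norm _).trans ((norm_sum_le _ _).trans ?_)
  have hwsum : ∑ m ∈ I, ‖W m‖ = (1 + τ) ^ Λ.card := by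
    simp only [hW, norm_prod]
    rw [hI, ← Finset.prod_univ_sum J (fun t j => ‖w t j‖)]
    have h3 : ∀ t, ∑ j ∈ J t, ‖w t j‖ = if t ∈ Λ then 1 + τ else 1 := by
      intro t
      by_cases ht : t ∈ Λ
      · simp only [hJ, ht, if_true]
        rw [Finset.sum_insert (by decide), Finset.sum_insert (by decide), Finset.sum_singleton]
        simp only [hw]
        norm_num [hc, abs_of_nonneg hτ0]
        ring
      · simp [hJ, ht, hw]
    simp only [h3]
    rw [Finset.prod_ite_mem, Finset.univ_inter, Finset.prod_const]
  have h0I : (0 : ZMod N → ℤ) ∈ I := by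
    rw [hI, Fintype.mem_piFinset]
    intro t
    simp only [hJ]
    split_ifs <;> simp
  have hnorm : ∀ m, ‖W m * bohrFourier N Γ δ' (θ m) ^ l * ZMod.stdAddChar (θ m * x)‖ =
      ‖W m‖ * ‖bohrFourier N Γ δ' (θ m)‖ ^ l := by
    intro m
    rw [norm_mul, norm_mul, norm_pow, di_norm_e, mul_one]
  simp only [hnorm]
  rw [← Finset.add_sum_erase _ _ h0I, ← hwsum, Finset.mul_sum, ← Finset.add_sum_erase _ _ h0I]
  have hW0 : W 0 = 1 := by simp [hW, hw]
  have hb0 : bohrFourier N Γ δ' (θ 0) = 1 := by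
    rw [di_bohrFourier]
    have : θ 0 = 0 := by simp [hθ]
    rw [this]
    have := di_bohr_card_pos N Γ hδ'.le
    have h4 : ((bohr N Γ δ').card : ℂ) ≠ 0 := by exact_mod_cast this.ne'
    simp [h4]
  rw [hW0, hb0]
  have hrest : ∑ m ∈ I.erase 0, ‖W m‖ * ‖bohrFourier N Γ δ' (θ m)‖ ^ l ≤
      ∑ m ∈ I.erase 0, (1 / 3) ^ l * ‖W m‖ := by
    apply Finset.sum_le_sum
    intro m hm
    rw [mul_comm]
    apply mul_le_mul_of_nonneg_right _ (norm_nonneg _)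
    apply pow_le_pow_left₀ (norm_nonneg _)
    by_contra hcon
    push Not at hcon
    obtain ⟨hm0, hmI⟩ := Finset.mem_erase.1 hm
    rw [hI, Fintype.mem_piFinset] at hmI
    have hout : ∀ t, t ∉ Λ → m t = 0 := by
      intro t ht
      have := hmI t
      simpa [hJ, ht] using this
    have hin : ∀ t ∈ Λ, m t = -1 ∨ m t = 0 ∨ m t = 1 := by
      intro t ht
      have := hmI t
      simpa [hJ, ht] using this
    have hθm : θ m = ∑ t ∈ Λ, m t • t := by
      simp only [hθ]
      symm
      apply Finset.sum_subset (Finset.subset_univ _)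
      intro t _ ht
      rw [hout t ht, zero_smul]
    have := hdiss m hin (by
      rw [← hθm]; exact hcon.le)
    apply hm0
    funext t
    by_cases ht : t ∈ Λ
    · exact this t ht
    · exact hout t ht
  have : (0 : ℝ) ≤ (1 / 3) ^ l * ‖(1 : ℂ)‖ := by positivity
  simp only [norm_one, one_pow, mul_one] at *
  linarith
/-- One factor of the sampled product. -/
noncomputable def diq (N : ℕ) [NeZero N] (c : ZMod N → ℂ) (t x : ZMod N) : ℝ :=
  1 + 1 / 2 * (c t * ZMod.stdAddChar (-(t * x))).re

lemma di_re_bound (N : ℕ) [NeZero N] (c : ZMod N → ℂ) (hc : ∀ t, ‖c t‖ = 1) (t x : ZMod N) :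
    |(c t * ZMod.stdAddChar (-(t * x))).re| ≤ 1 := by
  have h1 := Complex.abs_re_le_norm (c t * ZMod.stdAddChar (-(t * x)))
  rwa [norm_mul, hc, di_norm_e, one_mul] at h1

lemma di_diq_ge (N : ℕ) [NeZero N] (c : ZMod N → ℂ) (hc : ∀ t, ‖c t‖ = 1) (t x : ZMod N) :
    1 / 2 ≤ diq N c t x := by
  have := abs_le.1 (di_re_bound N c hc t x)
  unfold diq; linarith

lemma di_diq_shift (N : ℕ) [NeZero N] (c : ZMod N → ℂ) (hc : ∀ t, ‖c t‖ = 1) (t x y : ZMod N)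
    (δ : ℝ) (hy : ‖ZMod.toAddCircle (t * y)‖ ≤ δ) :
    diq N c t x ≤ (1 + 2 * Real.pi * δ) * diq N c t (x - y) := by
  have h1 : diq N c t x - diq N c t (x - y) ≤ Real.pi * δ := by
    unfold diq
    have h2 : (c t * ZMod.stdAddChar (-(t * x))).re - (c t * ZMod.stdAddChar (-(t * (x - y)))).re
        = -(c t * ZMod.stdAddChar (-(t * x)) * (ZMod.stdAddChar (t * y) - 1)).re := by
      have h3 : (ZMod.stdAddChar (-(t * (x - y))) : ℂ) =
          ZMod.stdAddChar (-(t * x)) * ZMod.stdAddChar (t * y) := by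
        rw [← AddChar.map_add_eq_mul]; congr 1; ring
      rw [h3, ← Complex.sub_re, ← Complex.neg_re]
      congr 1; ring
    have h4 := Complex.abs_re_le_norm
      (c t * ZMod.stdAddChar (-(t * x)) * (ZMod.stdAddChar (t * y) - 1))
    rw [norm_mul, norm_mul, hc, di_norm_e, one_mul, one_mul] at h4
    have h5 := h4.trans (di_norm_e_sub N (t * y))
    have h6 := (abs_le.1 h5).1
    have := Real.pi_pos
    nlinarith
  have h2 := di_diq_ge N c hc t (x - y)
  have h3 : 0 ≤ Real.pi * δ := mul_nonneg Real.pi_pos.le ((norm_nonneg _).trans hy)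
  nlinarith

lemma di_shift (N : ℕ) [NeZero N] (Γ Γ' : Finset (ZMod N)) (hΓ : Γ ⊆ Γ') (δ δ' δ'' : ℝ)
    (h0 : 0 < δ'') (h1 : δ'' ≤ δ') (A : Finset (ZMod N)) (hA : A ⊆ bohr N Γ δ)
    (c : ZMod N → ℂ) (hc : ∀ t, ‖c t‖ = 1) (k : ℕ) (v : Fin k → ZMod N) (hv : ∀ i, v i ∈ Γ')
    (D : ℝ) (hD : ∀ x, ((A ∩ (bohr N Γ' δ'').image (fun y => x + y)).card : ℝ) ≤
      D * (bohr N Γ' δ'').card) :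
    ∑ a ∈ A, ∏ i, diq N c (v i) a ≤
      (1 + 2 * Real.pi * δ') ^ k * (D * ∑ x ∈ bohr N Γ (δ + δ'), ∏ i, diq N c (v i) x) := by
  classical
  set p : ZMod N → ℝ := fun x => ∏ i, diq N c (v i) x with hp
  set B := bohr N Γ' δ'' with hB
  have hBc : 0 < (B.card : ℝ) := di_bohr_card_pos N Γ' h0.le
  have hq0 : ∀ t x, 0 ≤ diq N c t x := fun t x => by have := di_diq_ge N c hc t x; linarith
  have hp0 : ∀ x, 0 ≤ p x := fun x => Finset.prod_nonneg fun i _ => hq0 _ _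
  have hC : 0 ≤ (1 + 2 * Real.pi * δ') ^ k := by have := Real.pi_pos; have : 0 < δ' := h0.trans_le h1; positivity
  have hps : ∀ a, ∀ y ∈ B, p a ≤ (1 + 2 * Real.pi * δ') ^ k * p (a - y) := by
    intro a y hy
    have : (1 + 2 * Real.pi * δ') ^ k * p (a - y) =
        ∏ i : Fin k, ((1 + 2 * Real.pi * δ') * diq N c (v i) (a - y)) := by
      rw [Finset.prod_mul_distrib]; simp [hp]
    rw [this]
    apply Finset.prod_le_prod
    · intro i _; exact hq0 _ _
    · intro i _
      apply di_diq_shift N c hc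
      rw [hB, di_mem_bohr] at hy
      exact (hy _ (hv i)).trans h1
  have hin : ∀ a ∈ A, ∑ y ∈ B, p (a - y) =
      ∑ x ∈ bohr N Γ (δ + δ'), if a ∈ B.image (fun y => x + y) then p x else 0 := by
    intro a ha
    rw [← Finset.sum_filter]
    have : Finset.filter (fun x => a ∈ B.image (fun y => x + y)) (bohr N Γ (δ + δ')) =
        B.image (fun y => a - y) := by
      ext x
      simp only [Finset.mem_filter, Finset.mem_image]
      constructor
      · rintro ⟨_, y, hy, hxy⟩
        exact ⟨y, hy, by rw [← hxy]; ring⟩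
      · rintro ⟨y, hy, rfl⟩
        refine ⟨?_, y, hy, by ring⟩
        rw [sub_eq_add_neg]
        apply di_bohr_add N Γ (hA ha)
        exact di_bohr_neg N Γ (di_bohr_mono N Γ h1 (di_bohr_anti N hΓ _ hy))
    rw [this, Finset.sum_image]
    intro y _ z _ h
    simpa using h
  have hmain : ∑ a ∈ A, ∑ y ∈ B, p (a - y) ≤ D * B.card * ∑ x ∈ bohr N Γ (δ + δ'), p x := by
    rw [Finset.sum_congr rfl hin, Finset.sum_comm, Finset.mul_sum]
    apply Finset.sum_le_sum
    intro x _
    rw [← Finset.sum_filter, Finset.sum_const, nsmul_eq_mul, Finset.filter_mem_eq_inter]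
    exact mul_le_mul_of_nonneg_right (hD x) (hp0 x)
  have h2 : B.card * ∑ a ∈ A, p a ≤
      (1 + 2 * Real.pi * δ') ^ k * ∑ a ∈ A, ∑ y ∈ B, p (a - y) := by
    rw [Finset.mul_sum, Finset.mul_sum]
    apply Finset.sum_le_sum
    intro a _
    rw [Finset.mul_sum, ← nsmul_eq_mul]
    exact Finset.card_nsmul_le_sum _ _ _ (hps a)
  have h3 : B.card * ∑ a ∈ A, p a ≤ B.card *
      ((1 + 2 * Real.pi * δ') ^ k * (D * ∑ x ∈ bohr N Γ (δ + δ'), p x)) := by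
    refine h2.trans ((mul_le_mul_of_nonneg_left hmain hC).trans (le_of_eq ?_))
    ring
  exact le_of_mul_le_mul_left h3 hBc

lemma di_upper (N : ℕ) [NeZero N] (Γ : Finset (ZMod N)) {δ' : ℝ} (hδ' : 0 < δ') (r : ℝ)
    (Λ : Finset (ZMod N)) (hΛ : Λ.Nonempty)
    (hdiss : SDissociated {t : ZMod N | 1 / 3 ≤ ‖bohrFourier N Γ δ' t‖} Λ)
    (c : ZMod N → ℂ) (hc : ∀ t, ‖c t‖ = 1) (k : ℕ) (hk : k ≤ Λ.card) (l : ℕ) :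
    ∑ x ∈ bohr N Γ r, (∑ t ∈ Λ, diq N c t x) ^ k ≤
      (Λ.card : ℝ) ^ k * (Real.exp ((k : ℝ) ^ 2 / (4 * Λ.card)) *
        ((1 + (1 / 3) ^ l * Real.exp (k / 2)) * (bohr N Γ (r + l * δ')).card)) := by
  set n : ℝ := (Λ.card : ℝ) with hn
  have hn0 : 0 < n := by rw [hn]; exact_mod_cast Finset.card_pos.2 hΛ
  have hkn : (k : ℝ) ≤ n := by rw [hn]; exact_mod_cast hk
  set s : ℝ := k / (2 * n) with hs
  have hs0 : 0 ≤ s := by positivity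
  have hs1 : s ≤ 1 := by rw [hs, div_le_one (by positivity)]; linarith
  set τ : ℝ := s / (1 + s ^ 2) with hτ
  have hτ0 : 0 ≤ τ := by positivity
  have hτs : τ ≤ s := by
    rw [hτ]; apply div_le_self hs0; nlinarith
  have hpt : ∀ x, (∑ t ∈ Λ, diq N c t x) ^ k ≤ n ^ k * (Real.exp ((k : ℝ) ^ 2 / (4 * n)) *
      ∏ t ∈ Λ, (1 + τ * (c t * ZMod.stdAddChar (-(t * x))).re)) := by
    intro x
    set f : ZMod N → ℝ := fun t => (c t * ZMod.stdAddChar (-(t * x))).re with hf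
    have hfb : ∀ t, |f t| ≤ 1 := fun t => di_re_bound N c hc t x
    have hnn : 0 ≤ ∑ t ∈ Λ, diq N c t x :=
      Finset.sum_nonneg fun t _ => by have := di_diq_ge N c hc t x; linarith
    have h1 : ∑ t ∈ Λ, diq N c t x = n * (1 + (∑ t ∈ Λ, f t) / (2 * n)) := by
      simp only [diq, Finset.sum_add_distrib, ← Finset.mul_sum, Finset.sum_const, nsmul_eq_mul]
      field_simp
      rw [hn]; ring
    rw [h1] at hnn ⊢
    have h2 : 0 ≤ 1 + (∑ t ∈ Λ, f t) / (2 * n) := nonneg_of_mul_nonneg_right hnn hn0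
    rw [mul_pow]
    apply mul_le_mul_of_nonneg_left _ (by positivity)
    have h3 : (1 + (∑ t ∈ Λ, f t) / (2 * n)) ^ k ≤ ∏ t ∈ Λ, Real.exp (s * f t) := by
      rw [← Real.exp_sum, ← Finset.mul_sum]
      calc (1 + (∑ t ∈ Λ, f t) / (2 * n)) ^ k ≤ (Real.exp ((∑ t ∈ Λ, f t) / (2 * n))) ^ k := by
            apply pow_le_pow_left₀ h2
            have := Real.add_one_le_exp ((∑ t ∈ Λ, f t) / (2 * n))
            linarith
        _ = _ := by
            rw [← Real.exp_nat_mul]; congr 1; rw [hs]; ring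
    refine h3.trans ?_
    have h4 : ∏ t ∈ Λ, Real.exp (s * f t) ≤ ∏ t ∈ Λ, (Real.exp (s ^ 2) * (1 + τ * f t)) := by
      apply Finset.prod_le_prod
      · intro t _; positivity
      · intro t _
        have hb := hfb t
        have hsf : |s * f t| ≤ 1 := by
          rw [abs_mul, abs_of_nonneg hs0]; nlinarith [abs_nonneg (f t)]
        have h5 := (abs_le.1 (Real.abs_exp_sub_one_sub_id_le hsf)).2
        have h6 : (s * f t) ^ 2 ≤ s ^ 2 := by
          rw [mul_pow]
          have : f t ^ 2 ≤ 1 := by rw [← sq_abs]; nlinarith [abs_nonneg (f t)]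
          nlinarith [sq_nonneg s]
        have h7 : 1 + s ^ 2 + s * f t = (1 + s ^ 2) * (1 + τ * f t) := by
          rw [hτ]; field_simp
        have h8 : 0 ≤ 1 + τ * f t := by
          have := abs_le.1 hb; nlinarith
        have h9 := Real.add_one_le_exp (s ^ 2)
        calc Real.exp (s * f t) ≤ (1 + s ^ 2) * (1 + τ * f t) := by linarith
          _ ≤ _ := mul_le_mul_of_nonneg_right (by linarith) h8
    refine h4.trans (le_of_eq ?_)
    rw [Finset.prod_mul_distrib, Finset.prod_const, ← Real.exp_nat_mul, ← hn]
    congr 2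
    rw [hs]; field_simp; ring
  refine (Finset.sum_le_sum fun x _ => hpt x).trans ?_
  rw [← Finset.mul_sum, ← Finset.mul_sum]
  have hr := di_riesz N Γ hδ' r Λ hdiss c hc τ hτ0 (hτs.trans hs1) l
  have hexp : (1 + τ) ^ Λ.card ≤ Real.exp (k / 2) := by
    calc (1 + τ) ^ Λ.card ≤ (Real.exp s) ^ Λ.card := by
          apply pow_le_pow_left₀ (by linarith)
          have := Real.add_one_le_exp s
          linarith
      _ = _ := by
          rw [← Real.exp_nat_mul, ← hn]; congr 1; rw [hs]; field_simp
  gcongr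
  refine hr.trans ?_
  gcongr
lemma di_lower (N : ℕ) [NeZero N] (A : Finset (ZMod N)) (hA : 0 < (A.card : ℝ))
    (Λ : Finset (ZMod N)) (ρ : ℝ) (hρ0 : 0 < ρ) (hρ1 : ρ ≤ 1)
    (c : ZMod N → ℂ) (hc : ∀ t, ‖c t‖ = 1)
    (hbig : ∀ t ∈ Λ, ρ * A.card ≤ ∑ a ∈ A, (c t * ZMod.stdAddChar (-(t * a))).re)
    (k : ℕ) (hk : 1 ≤ k) :
    (A.card : ℝ) * ((Λ.card : ℝ) ^ k * Real.exp (k * ρ / 3)) ≤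
      ∑ a ∈ A, (∑ t ∈ Λ, diq N c t a) ^ k := by
  obtain ⟨j, rfl⟩ : ∃ j, k = j + 1 := ⟨k - 1, by omega⟩
  have hnn : ∀ a ∈ A, 0 ≤ ∑ t ∈ Λ, diq N c t a := fun a _ =>
    Finset.sum_nonneg fun t _ => by have := di_diq_ge N c hc t a; linarith
  refine le_trans ?_ (pow_sum_div_card_le_sum_pow hnn j)
  rw [le_div_iff₀ (by positivity)]
  have h1 : (A.card : ℝ) * Λ.card * Real.exp (ρ / 3) ≤ ∑ a ∈ A, ∑ t ∈ Λ, diq N c t a := by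
    rw [Finset.sum_comm]
    have h2 : ∀ t ∈ Λ, (A.card : ℝ) * (1 + ρ / 2) ≤ ∑ a ∈ A, diq N c t a := by
      intro t ht
      simp only [diq, Finset.sum_add_distrib, ← Finset.mul_sum, Finset.sum_const, nsmul_eq_mul]
      have := hbig t ht
      linarith
    have h3 := Finset.card_nsmul_le_sum Λ _ _ h2
    rw [nsmul_eq_mul] at h3
    have h4 : Real.exp (ρ / 3) ≤ 1 + ρ / 2 := by
      have h5 := Real.one_sub_le_exp_neg (ρ / 3)
      rw [Real.exp_neg] at h5
      have h6 := Real.exp_pos (ρ / 3)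
      have h7 : (1 - ρ / 3) * Real.exp (ρ / 3) ≤ 1 := by
        calc _ ≤ (Real.exp (ρ / 3))⁻¹ * Real.exp (ρ / 3) := by gcongr
          _ = 1 := inv_mul_cancel₀ h6.ne'
      have h8 : 1 ≤ (1 - ρ / 3) * (1 + ρ / 2) := by nlinarith
      have h9 : 0 < 1 - ρ / 3 := by linarith
      exact le_of_mul_le_mul_left (h7.trans h8) h9
    calc _ ≤ (A.card : ℝ) * Λ.card * (1 + ρ / 2) := by gcongr
      _ ≤ _ := by linarith
  have h2 := pow_le_pow_left₀ (by positivity) h1 (j + 1)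
  refine le_trans (le_of_eq ?_) h2
  rw [mul_pow, mul_pow, ← Real.exp_nat_mul]
  have : ((j + 1 : ℕ) : ℝ) * ρ / 3 = ((j + 1 : ℕ) : ℝ) * (ρ / 3) := by ring
  rw [this]; ring

lemma di_kappa (d ρ α : ℝ) (hd : 0 ≤ d) (hρ0 : 0 < ρ) (hρ1 : ρ ≤ 1) (hα0 : 0 < α) (hα1 : α ≤ 1) :
    (1 + d) * (ρ * α / (2 * (1 + d))) ^ (2 ^ 6 : ℕ) ≤ (1 / 2) ^ 60 * (ρ ^ 4 * α ^ 4) := by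
  set y := ρ * α / (2 * (1 + d)) with hy
  have hy0 : 0 ≤ y := by positivity
  have h1 : y * (1 + d) ≤ ρ * α := by
    rw [hy]; field_simp; norm_num
  have hra : ρ * α ≤ 1 := by nlinarith
  have h2 : y ≤ ρ * α / 2 := by
    rw [hy]; apply div_le_div_of_nonneg_left (by positivity) (by norm_num); linarith
  have h3 : y ≤ 1 / 2 := by linarith
  have h4 : y ≤ ρ * α := by nlinarith
  calc (1 + d) * y ^ (2 ^ 6 : ℕ) = y ^ 60 * (y * (1 + d)) * y ^ 3 := by norm_num; ring
    _ ≤ (1 / 2) ^ 60 * (ρ * α) * (ρ * α) ^ 3 := by gcongr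
    _ = _ := by ring

lemma di_b1 (κ d ρ α δ δ' x1 : ℝ) (k : ℕ) (hκ0 : 0 < κ)
    (hκ : (1 + d) * κ ≤ (1 / 2) ^ 60 * (ρ ^ 4 * α ^ 4)) (hd0 : 0 ≤ d)
    (hρ0 : 0 < ρ) (hρ1 : ρ ≤ 1) (hα0 : 0 < α) (hα1 : α ≤ 1) (hδ1 : δ ≤ 1) (hδ'0 : 0 < δ')
    (hδ'u : δ' ≤ 4 * κ * δ) (hx1 : x1 = 2 * Real.pi * δ') : k * x1 ≤ k * ρ / 32 := by
  have h1 : κ ≤ (1 / 2) ^ 60 * ρ := by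
    have h2 : κ ≤ (1 + d) * κ := by nlinarith
    refine (h2.trans hκ).trans ?_
    have : ρ ^ 4 * α ^ 4 ≤ ρ := by
      have h3 : ρ ^ 3 * α ^ 4 ≤ 1 := by
        calc ρ ^ 3 * α ^ 4 ≤ 1 ^ 3 * 1 ^ 4 := by gcongr
          _ = 1 := by norm_num
      calc ρ ^ 4 * α ^ 4 = ρ * (ρ ^ 3 * α ^ 4) := by ring
        _ ≤ ρ * 1 := by gcongr
        _ = ρ := mul_one _
    gcongr
  have h2 : δ' ≤ 4 * κ := by
    refine hδ'u.trans ?_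
    nlinarith
  have h3 : x1 ≤ ρ / 32 := by
    have hpi := Real.pi_lt_four
    have h4 : x1 ≤ 8 * δ' := by rw [hx1]; nlinarith
    norm_num at h1
    linarith
  calc k * x1 ≤ k * (ρ / 32) := by gcongr
    _ = _ := by ring

lemma di_b4 (ρ x4 : ℝ) (k l : ℕ) (hρ0 : 0 < ρ) (hk1 : (1 : ℝ) ≤ k) (hl : l = k + ⌈32 / ρ⌉₊)
    (hx4 : x4 = (1 / 3) ^ l * Real.exp (k / 2)) : x4 ≤ k * ρ / 32 := by
  have h1 : Real.exp (k / 2) ≤ 3 ^ k := by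
    have h2 : Real.exp ((k : ℝ) / 2) = Real.exp (1 / 2) ^ k := by
      rw [← Real.exp_nat_mul]; congr 1; ring
    rw [h2]
    apply pow_le_pow_left₀ (by positivity)
    have h3 := Real.exp_one_lt_d9
    have h4 : Real.exp (1 / 2) ≤ Real.exp 1 := Real.exp_le_exp.2 (by norm_num)
    linarith
  have h2 : x4 ≤ (1 / 3) ^ ⌈32 / ρ⌉₊ := by
    rw [hx4, hl, pow_add]
    calc (1 / 3 : ℝ) ^ k * (1 / 3) ^ ⌈32 / ρ⌉₊ * Real.exp (k / 2)
        ≤ (1 / 3 : ℝ) ^ k * (1 / 3) ^ ⌈32 / ρ⌉₊ * 3 ^ k := by gcongr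
      _ = (1 / 3 * 3 : ℝ) ^ k * (1 / 3) ^ ⌈32 / ρ⌉₊ := by rw [mul_pow]; ring
      _ = _ := by norm_num
  have h3 : 32 / ρ ≤ (3 : ℝ) ^ ⌈32 / ρ⌉₊ := by
    refine (Nat.le_ceil _).trans ?_
    exact_mod_cast (Nat.lt_pow_self (by norm_num : 1 < 3)).le
  have h4 : (1 / 3 : ℝ) ^ ⌈32 / ρ⌉₊ ≤ ρ / 32 := by
    rw [one_div, inv_pow]
    have := inv_anti₀ (by positivity) h3
    rwa [inv_div] at this
  have h5 : ρ / 32 ≤ k * ρ / 32 := by nlinarith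
  linarith

lemma di_b2 (ρ n L K g : ℝ) (k : ℕ) (hρ0 : 0 < ρ) (hL0 : 0 < L) (hK : K = ρ * n / (2 ^ 4 * L))
    (hg : g = ρ ^ 2 * n / (2 ^ 12 * L)) (hkK' : K / 2 ≤ k) : g ≤ k * ρ / 32 := by
  have : g = K * ρ / 256 := by rw [hg, hK]; field_simp; norm_num
  rw [this]
  have h0 : (0 : ℝ) ≤ k := Nat.cast_nonneg _
  nlinarith

lemma di_b3 (ρ n K x3 : ℝ) (k : ℕ) (hn0 : 0 < n) (hkK : (k : ℝ) ≤ K)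
    (hKn : K ≤ ρ * n / 16) (hx3 : x3 = (k : ℝ) ^ 2 / (4 * n)) : x3 ≤ k * ρ / 32 := by
  rw [hx3, div_le_iff₀ (by positivity)]
  have : (k : ℝ) ≤ ρ * n / 16 := hkK.trans hKn
  have h0 : (0 : ℝ) ≤ k := Nat.cast_nonneg _
  nlinarith [mul_le_mul_of_nonneg_left this h0]

lemma di_eta (κ d ρ α δ δ' η n : ℝ) (k l : ℕ) (hκ0 : 0 < κ)
    (hκ : (1 + d) * κ ≤ (1 / 2) ^ 60 * (ρ ^ 4 * α ^ 4)) (hd0 : 0 ≤ d)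
    (hρ0 : 0 < ρ) (hρ1 : ρ ≤ 1) (hα0 : 0 < α) (hα1 : α ≤ 1) (hδ0 : 0 < δ) (hδ'0 : 0 < δ')
    (hδ'u : δ' ≤ 4 * κ * δ) (hη : η = (l + 1) * δ' / δ) (hη0 : 0 ≤ η)
    (hl : l = k + ⌈32 / ρ⌉₊) (hk1 : (1 : ℝ) ≤ k) (hkn : (k : ℝ) ≤ n)
    (hΛu : n * (ρ ^ 2 * α ^ 2) ≤ 2 ^ 14) :
    d * η ≤ 1 / 16 ∧ 16 * (d * η) ≤ k * ρ / 32 := by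
  have hll : ((l : ℝ) + 1) * ρ ≤ 35 * k := by
    have h1 := Nat.ceil_lt_add_one (a := 32 / ρ) (by positivity)
    have h2 : (l : ℝ) = k + (⌈32 / ρ⌉₊ : ℝ) := by rw [hl]; push_cast; ring
    have h3 : (l : ℝ) + 1 ≤ k + 32 / ρ + 2 := by linarith
    have h4 : (k + 32 / ρ + 2) * ρ = k * ρ + 32 + 2 * ρ := by field_simp
    have h5 : ((l : ℝ) + 1) * ρ ≤ k * ρ + 32 + 2 * ρ := by rw [← h4]; gcongr
    have h6 : k * ρ ≤ k := mul_le_of_le_one_right (by linarith) hρ1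
    linarith
  have hdη : d * η ≤ (1 / 2) ^ 52 * (ρ ^ 3 * α ^ 4 * k) := by
    have h1 : δ' / δ ≤ 4 * κ := by rw [div_le_iff₀ hδ0]; linarith
    have h2 : d * η = (l + 1) * (d * (δ' / δ)) := by rw [hη]; ring
    have h3 : d * (δ' / δ) ≤ 4 * ((1 / 2) ^ 60 * (ρ ^ 4 * α ^ 4)) := by
      have : d * (δ' / δ) ≤ d * (4 * κ) := by gcongr
      nlinarith
    rw [h2]
    calc ((l : ℝ) + 1) * (d * (δ' / δ)) ≤ (l + 1) * (4 * ((1 / 2) ^ 60 * (ρ ^ 4 * α ^ 4))) := by gcongr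
      _ = (((l : ℝ) + 1) * ρ) * (4 * ((1 / 2) ^ 60 * (ρ ^ 3 * α ^ 4))) := by ring
      _ ≤ (35 * k) * (4 * ((1 / 2) ^ 60 * (ρ ^ 3 * α ^ 4))) := by gcongr
      _ ≤ _ := by
          have : 0 ≤ ρ ^ 3 * α ^ 4 * k := by positivity
          norm_num; nlinarith
  have hρ2 : ρ ^ 2 ≤ 1 := by nlinarith
  have hα2 : α ^ 2 ≤ 1 := by nlinarith
  have hα4 : α ^ 4 ≤ 1 := by nlinarith
  have hdη1 : d * η ≤ 1 / 16 := by
    have h1 : (k : ℝ) * (ρ ^ 2 * α ^ 2) ≤ 2 ^ 14 := le_trans (by gcongr) hΛu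
    have h2 : ρ ^ 3 * α ^ 4 * k ≤ 2 ^ 14 := by
      have : ρ ^ 3 * α ^ 4 * k = (ρ * α ^ 2) * (k * (ρ ^ 2 * α ^ 2)) := by ring
      rw [this]
      calc _ ≤ 1 * ((k : ℝ) * (ρ ^ 2 * α ^ 2)) := by
            gcongr
            nlinarith [sq_nonneg α]
        _ ≤ _ := by linarith
    norm_num at hdη h2 ⊢
    linarith
  have hdη2 : 16 * (d * η) ≤ k * ρ / 32 := by
    have h2 : ρ ^ 3 * α ^ 4 * k ≤ k * ρ := by
      have : ρ ^ 3 * α ^ 4 * k = (ρ ^ 2 * α ^ 4) * (k * ρ) := by ring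
      rw [this]
      have h3 : ρ ^ 2 * α ^ 4 ≤ 1 := by
        have : 0 ≤ α ^ 4 := by positivity
        nlinarith
      calc _ ≤ 1 * ((k : ℝ) * ρ) := by gcongr
        _ = _ := one_mul _
    norm_num at hdη ⊢
    have : 0 < k * ρ := by positivity
    linarith
  exact ⟨hdη1, hdη2⟩

set_option maxHeartbeats 1000000 in
lemma di_core (N : ℕ) [NeZero N] (Γ : Finset (ZMod N)) (δ : ℝ)
    (hδ0 : 0 < δ) (hδ1 : δ ≤ 1) (hreg : BohrRegular N Γ δ)
    (A : Finset (ZMod N)) (hA : A ⊆ bohr N Γ δ)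
    (α : ℝ) (hα : α = (A.card : ℝ) / (bohr N Γ δ).card) (hα0 : 0 < α) (hα1 : α ≤ 1)
    (ρ : ℝ) (hρ0 : 0 < ρ) (hρ1 : ρ ≤ 1) (L : ℝ) (hL1 : 1 ≤ L)
    (κ : ℝ) (hκ0 : 0 < κ) (hκ' : (1 + (Γ.card : ℝ)) * κ ≤ (1 / 2) ^ 60 * (ρ ^ 4 * α ^ 4))
    (δ' : ℝ)
    (hδ'l : 2 * κ * δ ≤ δ')
    (hδ'u : δ' ≤ 4 * κ * δ)
    (Λ : Finset (ZMod N))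
    (hdiss : SDissociated {t : ZMod N | 1 / 3 ≤ ‖bohrFourier N Γ δ' t‖} Λ)
    (hΛcard : 2 ^ 7 * ρ⁻¹ * L ≤ (Λ.card : ℝ))
    (hΛu : (Λ.card : ℝ) * (ρ ^ 2 * α ^ 2) ≤ 2 ^ 14)
    (hbig : ∀ l ∈ Λ, ρ * α * (bohr N Γ δ).card ≤
      ‖∑ a ∈ A,
        Complex.exp (-(2 * Real.pi * Complex.I * (((l * a).val : ℕ) : ℂ) / N))‖) :
    ∃ (Γ' : Finset (ZMod N)) (δ'' : ℝ), 0 < δ'' ∧ BohrRegular N Γ' δ'' ∧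
      κ * δ ≤ δ'' ∧
      (Γ'.card : ℝ) ≤ Γ.card + ρ * Λ.card / (2 ^ 4 * L) ∧
      ∃ x : ZMod N,
        α * (1 + ρ ^ 2 * Λ.card / (2 ^ 12 * L)) * (bohr N Γ' δ'').card ≤
          ((A ∩ (bohr N Γ' δ'').image (fun y => x + y)).card : ℝ) := by
  classical
  have hL0 : 0 < L := by linarith
  obtain ⟨d, hd⟩ : ∃ d : ℝ, d = (Γ.card : ℝ) := ⟨_, rfl⟩
  have hd0 : 0 ≤ d := by rw [hd]; exact Nat.cast_nonneg _
  have hκ := hκ'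
  rw [← hd] at hκ
  obtain ⟨n, hn⟩ : ∃ n : ℝ, n = (Λ.card : ℝ) := ⟨_, rfl⟩
  rw [← hn] at hΛcard hΛu
  rw [← hd, ← hn]
  have hBp := di_bohr_card_pos N Γ hδ0.le
  have hAc : (A.card : ℝ) = α * (bohr N Γ δ).card := by rw [hα]; field_simp
  have hAp : 0 < (A.card : ℝ) := by rw [hAc]; exact mul_pos hα0 hBp
  have hn0 : 0 < n := lt_of_lt_of_le (by positivity) hΛcard
  have hΛne : Λ.Nonempty := by
    rw [← Finset.card_pos]; rw [hn] at hn0; exact_mod_cast hn0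
  have hδ'0 : 0 < δ' := lt_of_lt_of_le (by positivity) hδ'l
  -- the unit coefficients
  have hcex : ∀ t : ZMod N, ∃ c : ℂ, ‖c‖ = 1 ∧
      (‖∑ a ∈ A, (ZMod.stdAddChar (-(t * a)) : ℂ)‖ : ℂ) =
        c * ∑ a ∈ A, (ZMod.stdAddChar (-(t * a)) : ℂ) := by
    intro t
    set S : ℂ := ∑ a ∈ A, (ZMod.stdAddChar (-(t * a)) : ℂ) with hS
    by_cases hS0 : S = 0
    · exact ⟨1, by simp, by simp [hS0]⟩
    · refine ⟨(‖S‖ : ℂ) / S, ?_, ?_⟩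
      · rw [norm_div, Complex.norm_real, norm_norm, div_self (norm_ne_zero_iff.2 hS0)]
      · field_simp
  choose c hc hcS using hcex
  have hbig' : ∀ t ∈ Λ, ρ * A.card ≤ ∑ a ∈ A, (c t * ZMod.stdAddChar (-(t * a))).re := by
    intro t ht
    have h1 := hbig t ht
    simp only [di_exp_neg] at h1
    rw [← Complex.re_sum, ← Finset.mul_sum, ← hcS, Complex.ofReal_re, hAc]
    linarith
  -- choice of k
  obtain ⟨K, hK⟩ : ∃ K : ℝ, K = ρ * n / (2 ^ 4 * L) := ⟨_, rfl⟩
  rw [← hK]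
  have hK8 : 8 ≤ K := by
    rw [hK, le_div_iff₀ (by positivity)]
    have h1 : ρ * (2 ^ 7 * ρ⁻¹ * L) ≤ ρ * n := by gcongr
    have h2 : ρ * (2 ^ 7 * ρ⁻¹ * L) = 2 ^ 7 * L := by field_simp
    linarith
  obtain ⟨k, hk⟩ : ∃ k : ℕ, k = ⌊K⌋₊ := ⟨_, rfl⟩
  have hkK : (k : ℝ) ≤ K := by rw [hk]; exact Nat.floor_le (by linarith)
  have hkK' : K / 2 ≤ k := by
    have := Nat.lt_floor_add_one K
    rw [← hk] at this
    linarith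
  have hk1 : (1 : ℝ) ≤ k := by linarith
  have hk1' : 1 ≤ k := by exact_mod_cast hk1
  have hKn : K ≤ ρ * n / 16 := by
    rw [hK]; apply div_le_div_of_nonneg_left (by positivity) (by norm_num); linarith
  have hkn : (k : ℝ) ≤ n := by
    have h1 : ρ * n ≤ n := mul_le_of_le_one_left hn0.le hρ1
    linarith
  have hkn' : k ≤ Λ.card := by rw [hn] at hkn; exact_mod_cast hkn
  by_contra hcon
  push Not at hcon
  obtain ⟨g, hg⟩ : ∃ g : ℝ, g = ρ ^ 2 * n / (2 ^ 12 * L) := ⟨_, rfl⟩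
  rw [← hg] at hcon
  have hg0 : 0 ≤ g := by rw [hg]; positivity
  -- every tuple
  have htuple : ∀ v ∈ Fintype.piFinset (fun _ : Fin k => Λ), ∑ a ∈ A, ∏ i, diq N c (v i) a ≤
      (1 + 2 * Real.pi * δ') ^ k *
        (α * (1 + g) * ∑ x ∈ bohr N Γ (δ + δ'), ∏ i, diq N c (v i) x) := by
    intro v hv
    obtain ⟨r, hr1, hr2, hrr⟩ := di_exists_regular N (Γ ∪ Finset.univ.image v)
      (δ := δ' / 2) (by linarith)
    have hδ2 : 0 < δ' / 2 := by linarith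
    have hr2' : r * (δ' / 2) ≤ δ' := by
      have := mul_le_mul_of_nonneg_right hr2 hδ2.le
      linarith
    have hr1' : κ * δ ≤ r * (δ' / 2) := by
      have := mul_le_mul_of_nonneg_right hr1 hδ2.le
      linarith
    apply di_shift N Γ (Γ ∪ Finset.univ.image v) Finset.subset_union_left δ δ' (r * (δ' / 2))
      (mul_pos (by linarith) (by linarith)) hr2' A hA c hc k v (fun i => Finset.mem_union_right _
        (Finset.mem_image_of_mem _ (Finset.mem_univ _)))
    intro x
    refine (hcon _ _ (mul_pos (by linarith) (by linarith)) hrr hr1' ?_ x).le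
    have h1 : (Γ ∪ Finset.univ.image v).card ≤ Γ.card + k := by
      refine (Finset.card_union_le _ _).trans ?_
      have := Finset.card_image_le (s := (Finset.univ : Finset (Fin k))) (f := v)
      simp at this
      omega
    have h2 : ((Γ ∪ Finset.univ.image v).card : ℝ) ≤ d + k := by rw [hd]; exact_mod_cast h1
    linarith
  have hsum : ∑ a ∈ A, (∑ t ∈ Λ, diq N c t a) ^ k ≤ (1 + 2 * Real.pi * δ') ^ k *
      (α * (1 + g) * ∑ x ∈ bohr N Γ (δ + δ'), (∑ t ∈ Λ, diq N c t x) ^ k) := by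
    simp only [Finset.sum_pow']
    rw [Finset.sum_comm, Finset.sum_comm (s := bohr N Γ (δ + δ')), Finset.mul_sum, Finset.mul_sum]
    exact Finset.sum_le_sum htuple
  -- choice of l
  obtain ⟨l, hl⟩ : ∃ l : ℕ, l = k + ⌈32 / ρ⌉₊ := ⟨_, rfl⟩
  have hup := di_upper N Γ hδ'0 (δ + δ') Λ hΛne hdiss c hc k hkn' l
  have hlow := di_lower N A hAp Λ ρ hρ0 hρ1 c hc hbig' k hk1'
  rw [← hn] at hup hlow
  -- regularity
  obtain ⟨η, hη⟩ : ∃ η : ℝ, η = (l + 1) * δ' / δ := ⟨_, rfl⟩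
  have hη0 : 0 ≤ η := by rw [hη]; positivity
  obtain ⟨hdη1, hdη2⟩ := di_eta κ d ρ α δ δ' η n k l hκ0 hκ hd0 hρ0 hρ1 hα0 hα1 hδ0 hδ'0 hδ'u hη hη0
    hl hk1 hkn hΛu
  have hregη := (hreg η (by rw [abs_of_nonneg hη0, ← hd]; norm_num; linarith)).2
  have hrad : (1 + η) * δ = δ + δ' + l * δ' := by rw [hη]; field_simp; ring
  rw [hrad, abs_of_nonneg hη0, ← hd] at hregη
  -- assemble
  obtain ⟨Bc, hBc⟩ : ∃ Bc : ℝ, Bc = ((bohr N Γ δ).card : ℝ) := ⟨_, rfl⟩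
  obtain ⟨x1, hx1⟩ : ∃ x1 : ℝ, x1 = 2 * Real.pi * δ' := ⟨_, rfl⟩
  obtain ⟨x3, hx3⟩ : ∃ x3 : ℝ, x3 = (k : ℝ) ^ 2 / (4 * n) := ⟨_, rfl⟩
  obtain ⟨x4, hx4⟩ : ∃ x4 : ℝ, x4 = (1 / 3) ^ l * Real.exp (k / 2) := ⟨_, rfl⟩
  rw [← hBc] at hregη hBp hAc
  rw [← hx1] at hsum
  rw [← hx3, ← hx4] at hup
  have hx10 : 0 ≤ x1 := by rw [hx1]; have := Real.pi_pos; positivity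
  have hx40 : 0 ≤ x4 := by rw [hx4]; positivity
  have hfin : (α * Bc * n ^ k) * Real.exp (k * ρ / 3) ≤
      (α * Bc * n ^ k) * Real.exp (k * x1 + g + x3 + x4 + 16 * (d * η)) := by
    have e1 : (1 + x1) ^ k ≤ Real.exp (k * x1) := by
      rw [Real.exp_nat_mul]
      apply pow_le_pow_left₀ (by linarith)
      linarith [Real.add_one_le_exp x1]
    have e2 : 1 + g ≤ Real.exp g := by linarith [Real.add_one_le_exp g]
    have e4 : 1 + x4 ≤ Real.exp x4 := by linarith [Real.add_one_le_exp x4]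
    have e5 : 1 + 16 * (d * η) ≤ Real.exp (16 * (d * η)) := by
      linarith [Real.add_one_le_exp (16 * (d * η))]
    have hregη' : ((bohr N Γ (δ + δ' + l * δ')).card : ℝ) ≤ Real.exp (16 * (d * η)) * Bc := by
      refine hregη.trans ?_
      apply mul_le_mul_of_nonneg_right _ hBp.le
      norm_num; linarith
    calc (α * Bc * n ^ k) * Real.exp (k * ρ / 3)
        = (A.card : ℝ) * (n ^ k * Real.exp (k * ρ / 3)) := by rw [hAc]; ring
      _ ≤ _ := hlow
      _ ≤ _ := hsum
      _ ≤ Real.exp (k * x1) * (α * Real.exp g * (n ^ k * (Real.exp x3 * (Real.exp x4 *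
          (Real.exp (16 * (d * η)) * Bc))))) := by
          apply mul_le_mul e1 _ _ (by positivity)
          · apply mul_le_mul _ _ _ (by positivity)
            · gcongr
            · refine hup.trans ?_
              refine mul_le_mul_of_nonneg_left ?_ (pow_nonneg hn0.le _)
              refine mul_le_mul_of_nonneg_left ?_ (Real.exp_pos _).le
              exact mul_le_mul e4 hregη' (Nat.cast_nonneg _) (Real.exp_pos _).le
            · apply Finset.sum_nonneg
              intro x _
              apply pow_nonneg
              exact Finset.sum_nonneg fun t _ => by
                have := di_diq_ge N c hc t x; linarith
          · apply mul_nonneg (by positivity)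
            apply Finset.sum_nonneg
            intro x _
            apply pow_nonneg
            exact Finset.sum_nonneg fun t _ => by
              have := di_diq_ge N c hc t x; linarith
      _ = _ := by
          rw [Real.exp_add, Real.exp_add, Real.exp_add, Real.exp_add]; ring
  have hfin2 := le_of_mul_le_mul_left hfin (by positivity)
  rw [Real.exp_le_exp] at hfin2
  have hkρ : 0 < k * ρ := by positivity
  have b1 := di_b1 κ d ρ α δ δ' x1 k hκ0 hκ hd0 hρ0 hρ1 hα0 hα1 hδ1 hδ'0 hδ'u hx1
  have b2 := di_b2 ρ n L K g k hρ0 hL0 hK hg hkK'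
  have b3 := di_b3 ρ n K x3 k hn0 hkK hKn hx3
  have b4 := di_b4 ρ x4 k l hρ0 hk1 hl hx4
  linarith
/-- **The density increment (Proposition 3.1).** Let `B(Γ,δ)` be a regular Bohr set,
`A ⊆ B(Γ,δ)` of relative density `α > 0`, and `ρ ∈ (0,1]`. Suppose
`2(ρα/(2(1+|Γ|)))^{2⁶} δ ≤ δ' ≤ 4(ρα/(2(1+|Γ|)))^{2⁶} δ`, and that `Λ` is an
`S`-dissociated set (for `S = {t : |β̂_{Γ,δ'}(t)| ≥ 1/3}`) of at least
`2⁷ ρ⁻¹ (1 + log α⁻¹)` frequencies, at each of which `|Σ_{a ∈ A} e^{-2πi λ a/N}| ≥ ρ α |B(Γ,δ)|`.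
Then there is a regular Bohr set `B(Γ',δ'')` with `δ'' ≥ (ρα/(2(1+|Γ|)))^{2⁶} δ` and
`|Γ'| ≤ |Γ| + ρ|Λ|/(2⁴(1 + log α⁻¹))` on (a translate of) which `A` has density at least
`α (1 + ρ²|Λ|/(2¹²(1 + log α⁻¹)))`. -/
theorem density_increment (N : ℕ) [NeZero N] (Γ : Finset (ZMod N)) (δ : ℝ)
    (hδ0 : 0 < δ) (hδ1 : δ ≤ 1) (hreg : BohrRegular N Γ δ)
    (A : Finset (ZMod N)) (hA : A ⊆ bohr N Γ δ)
    (α : ℝ) (hα : α = (A.card : ℝ) / (bohr N Γ δ).card) (hα0 : 0 < α)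
    (ρ : ℝ) (hρ0 : 0 < ρ) (hρ1 : ρ ≤ 1)
    (δ' : ℝ)
    (hδ'l : 2 * (ρ * α / (2 * (1 + Γ.card))) ^ (2 ^ 6 : ℕ) * δ ≤ δ')
    (hδ'u : δ' ≤ 4 * (ρ * α / (2 * (1 + Γ.card))) ^ (2 ^ 6 : ℕ) * δ)
    (Λ : Finset (ZMod N))
    (hdiss : SDissociated {t : ZMod N | 1 / 3 ≤ ‖bohrFourier N Γ δ' t‖} Λ)
    (hΛcard : 2 ^ 7 * ρ⁻¹ * (1 + Real.log α⁻¹) ≤ (Λ.card : ℝ))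
    (hbig : ∀ l ∈ Λ, ρ * α * (bohr N Γ δ).card ≤
      ‖∑ a ∈ A,
        Complex.exp (-(2 * Real.pi * Complex.I * (((l * a).val : ℕ) : ℂ) / N))‖) :
    ∃ (Γ' : Finset (ZMod N)) (δ'' : ℝ), 0 < δ'' ∧ BohrRegular N Γ' δ'' ∧
      (ρ * α / (2 * (1 + Γ.card))) ^ (2 ^ 6 : ℕ) * δ ≤ δ'' ∧
      (Γ'.card : ℝ) ≤ Γ.card + ρ * Λ.card / (2 ^ 4 * (1 + Real.log α⁻¹)) ∧
      ∃ x : ZMod N,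
        α * (1 + ρ ^ 2 * Λ.card / (2 ^ 12 * (1 + Real.log α⁻¹))) * (bohr N Γ' δ'').card ≤
          ((A ∩ (bohr N Γ' δ'').image (fun y => x + y)).card : ℝ) := by
  classical
  have hBp := di_bohr_card_pos N Γ hδ0.le
  have hα1 : α ≤ 1 := by
    rw [hα, div_le_one hBp]
    exact_mod_cast Finset.card_le_card hA
  have hL1 : 1 ≤ 1 + Real.log α⁻¹ := by
    have := Real.log_nonneg (one_le_inv_iff₀.2 ⟨hα0, hα1⟩)
    linarith
  have hL2 : 1 + Real.log α⁻¹ ≤ α⁻¹ := by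
    have := Real.log_le_sub_one_of_pos (inv_pos.2 hα0)
    linarith
  generalize 1 + Real.log α⁻¹ = L at hL1 hL2 hΛcard ⊢
  have hd0 : (0 : ℝ) ≤ (Γ.card : ℝ) := Nat.cast_nonneg _
  have hκ := di_kappa (Γ.card : ℝ) ρ α hd0 hρ0 hρ1 hα0 hα1
  have hκ0 : 0 < (ρ * α / (2 * (1 + (Γ.card : ℝ)))) ^ (2 ^ 6 : ℕ) :=
    pow_pos (div_pos (mul_pos hρ0 hα0) (by linarith)) _
  by_cases hΛu : (Λ.card : ℝ) * (ρ ^ 2 * α ^ 2) ≤ 2 ^ 14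
  · exact di_core N Γ δ hδ0 hδ1 hreg A hA α hα hα0 hα1 ρ hρ0 hρ1 L hL1 _ hκ0 hκ
      δ' hδ'l hδ'u Λ hdiss
      hΛcard hΛu hbig
  exfalso
  push Not at hΛu
  have hra : 0 < ρ ^ 2 * α ^ 2 := by positivity
  have hra1 : ρ ^ 2 * α ^ 2 ≤ 1 := by
    calc ρ ^ 2 * α ^ 2 ≤ 1 ^ 2 * 1 ^ 2 := by gcongr
      _ = 1 := by norm_num
  set n' : ℕ := ⌊2 ^ 14 / (ρ ^ 2 * α ^ 2)⌋₊ with hn'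
  have hn1 : (n' : ℝ) ≤ 2 ^ 14 / (ρ ^ 2 * α ^ 2) := Nat.floor_le (by positivity)
  have hn1' : (n' : ℝ) * (ρ ^ 2 * α ^ 2) ≤ 2 ^ 14 := by rwa [le_div_iff₀ hra] at hn1
  have hn2 : 2 ^ 13 ≤ (n' : ℝ) * (ρ ^ 2 * α ^ 2) := by
    have h1 := Nat.lt_floor_add_one (2 ^ 14 / (ρ ^ 2 * α ^ 2))
    rw [← hn', div_lt_iff₀ hra] at h1
    linarith
  have hnle : n' ≤ Λ.card := by
    have h1 : (n' : ℝ) ≤ Λ.card := by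
      have : (n' : ℝ) * (ρ ^ 2 * α ^ 2) ≤ Λ.card * (ρ ^ 2 * α ^ 2) := by linarith
      exact le_of_mul_le_mul_right this hra
    exact_mod_cast h1
  obtain ⟨Λ', hsub, hcard⟩ := Finset.exists_subset_card_eq hnle
  have hdiss' : SDissociated {t : ZMod N | 1 / 3 ≤ ‖bohrFourier N Γ δ' t‖} Λ' := by
    intro m hm hS t ht
    have h1 := hdiss (fun t => if t ∈ Λ' then m t else 0) (by
      intro s _
      by_cases hs : s ∈ Λ'
      · simpa [hs] using hm s hs
      · simp [hs]) (by
      have : ∑ s ∈ Λ, (if s ∈ Λ' then m s else 0) • s = ∑ s ∈ Λ', m s • s := by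
        rw [← Finset.sum_subset hsub]
        · apply Finset.sum_congr rfl
          intro s hs
          rw [if_pos hs]
        · intro s _ hs
          rw [if_neg hs, zero_smul]
      rw [this]; exact hS) t (hsub ht)
    simpa [ht] using h1
  have hc' : 2 ^ 7 * ρ⁻¹ * L ≤ (Λ'.card : ℝ) := by
    rw [hcard]
    have h1 : 2 ^ 7 * ρ⁻¹ * L * (ρ ^ 2 * α ^ 2) ≤ n' * (ρ ^ 2 * α ^ 2) := by
      calc 2 ^ 7 * ρ⁻¹ * L * (ρ ^ 2 * α ^ 2) ≤ 2 ^ 7 * ρ⁻¹ * α⁻¹ * (ρ ^ 2 * α ^ 2) := by gcongr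
        _ = 2 ^ 7 * (ρ * α) := by field_simp
        _ ≤ 2 ^ 7 * (1 * 1) := by gcongr
        _ ≤ _ := by linarith
    exact le_of_mul_le_mul_right h1 hra
  obtain ⟨Γ', δ'', h0, -, -, -, x, hx⟩ := di_core N Γ δ hδ0 hδ1 hreg A hA α hα hα0 hα1 ρ hρ0 hρ1 L
    hL1 _ hκ0 hκ δ' hδ'l hδ'u Λ' hdiss' hc' (by rw [hcard]; exact hn1') (fun t ht => hbig t (hsub ht))
  have hB'' := di_bohr_card_pos N Γ' h0.le
  have h1 : ((A ∩ (bohr N Γ' δ'').image (fun y => x + y)).card : ℝ) ≤ (bohr N Γ' δ'').card := by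
    exact_mod_cast (Finset.card_le_card Finset.inter_subset_right).trans Finset.card_image_le
  have h2 : 2 ≤ α * (1 + ρ ^ 2 * Λ'.card / (2 ^ 12 * L)) := by
    rw [hcard]
    have hL0 : 0 < L := by linarith
    have h3 : L * α ≤ 1 := by
      calc L * α ≤ α⁻¹ * α := by gcongr
        _ = 1 := inv_mul_cancel₀ hα0.ne'
    have h4 : 2 ≤ α * (ρ ^ 2 * n' / (2 ^ 12 * L)) := by
      rw [← mul_div_assoc, le_div_iff₀ (by positivity)]
      have h5 : α * (α * (ρ ^ 2 * n')) = n' * (ρ ^ 2 * α ^ 2) := by ring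
      have h6 : α * (2 * (2 ^ 12 * L)) ≤ α * (α * (ρ ^ 2 * n')) := by
        rw [h5]; linarith
      exact le_of_mul_le_mul_left h6 hα0
    linarith
  nlinarith
end
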